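/- arXiv:2408.17229 — 4 statements merged into one kernel-verified Lean document; each statement's English description precedes it below -/
import Mathlib

section
/- For all positive integers a, b, c with a ≤ b ≤ c and 3a ≥ b + c, it holds that f(a,b,c) ≤ ⌊(a+b+c)/2⌋. -/
/-- A question (and a secret) for `(a,b,c)`-Mastermind is a triple in
`Fin a × Fin b × Fin c`. -/
abbrev Question (a b c : ℕ) := Fin a × Fin b × Fin c

/-- `g s q` is the number of coordinates in which `s` and `q` agree. -/
def g {a b c : ℕ} (s q : Question a b c) : ℕ :=
  (if s.1 = q.1 then 1 else 0) + (if s.2.1 = q.2.1 then 1 else 0) +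
    (if s.2.2 = q.2.2 then 1 else 0)

/-- A finite set of questions is a feasible strategy if every pair of distinct
secrets is distinguished by some question. -/
def Feasible {a b c : ℕ} (Q : Finset (Question a b c)) : Prop :=
  ∀ s s' : Question a b c, s ≠ s' → ∃ q ∈ Q, g s q ≠ g s' q

/-- `f a b c` is the minimum cardinality of a feasible strategy for
`(a,b,c)`-Mastermind. -/
noncomputable def f (a b c : ℕ) : ℕ :=
  sInf {n : ℕ | ∃ Q : Finset (Question a b c), Feasible Q ∧ Q.card = n}


set_option maxHeartbeats 4000000 in
theorem comp_lemma {I : Type*} [Fintype I] [DecidableEq I] (σ : Equiv.Perm I)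
    (x x' y y' : Option I) (z z' : Option (I × Bool))
    (h : ∀ i b, (if x = some i then 1 else 0) + (if y = some (if b then σ i else i) then 1 else 0)
        + (if z = some (i, b) then 1 else 0) =
      (if x' = some i then 1 else 0) + (if y' = some (if b then σ i else i) then 1 else 0)
        + (if z' = some (i, b) then 1 else 0)) 
    (hσ : ∀ i, σ i = i → Subsingleton I) :
    (x = x' ∧ y = y' ∧ z = z') ∨
    (∃ i j, x = some i ∧ y = none ∧ x' = none ∧ y' = some j ∧
      ((z = none ∧ z' = none ∧ Subsingleton I) ∨ ∃ k k', z = some k ∧ z' = some k')) ∨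
    (∃ i j, x' = some i ∧ y' = none ∧ x = none ∧ y = some j ∧
      ((z = none ∧ z' = none ∧ Subsingleton I) ∨ ∃ k k', z = some k ∧ z' = some k')) := by
  have hF : ∀ i, (if x = some i then 1 else 0) + (if y = some i then 1 else 0)
        + (if z = some (i, false) then 1 else 0) =
      (if x' = some i then 1 else 0) + (if y' = some i then 1 else 0)
        + (if z' = some (i, false) then 1 else 0) := fun i => by simpa using h i false
  have hT : ∀ i, (if x = some i then 1 else 0) + (if y = some (σ i) then 1 else 0)
        + (if z = some (i, true) then 1 else 0) =
      (if x' = some i then 1 else 0) + (if y' = some (σ i) then 1 else 0)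
        + (if z' = some (i, true) then 1 else 0) := fun i => by simpa using h i true
  clear h
  let cnt : ∀ {J : Type _}, Option J → ℕ := fun o => if o.isSome then 1 else 0
  have hc : 2 * cnt x + 2 * cnt y + cnt z = 2 * cnt x' + 2 * cnt y' + cnt z' := by
    have key : ∀ (x y : Option I) (z : Option (I × Bool)), 2 * cnt x + 2 * cnt y + cnt z =
       ∑ i, ((if x = some i then 1 else 0) + (if y = some i then 1 else 0)
        + (if z = some (i, false) then 1 else 0)) +
       ∑ i, ((if x = some i then 1 else 0) + (if y = some (σ i) then 1 else 0)
        + (if z = some (i, true) then 1 else 0)) := by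
      intro x y z
      have e1 : ∀ x : Option I, ∑ i, (if x = some i then 1 else 0) = cnt x := by
        intro x; rcases x with _ | x <;> simp [cnt]
      have e2 : ∑ i, (if y = some (σ i) then 1 else 0) = cnt y := by
        rw [← e1 y]; exact Equiv.sum_comp σ (fun i => if y = some i then 1 else 0)
      have e3 : ∑ i, (if z = some (i, false) then 1 else 0) +
          ∑ i, (if z = some (i, true) then 1 else 0) = cnt z := by
        rcases z with _ | ⟨z, _ | _⟩ <;> simp [cnt]
      simp only [Finset.sum_add_distrib, e1, e2]
      omega
    rw [key, key, Finset.sum_congr rfl (fun i _ => hF i), Finset.sum_congr rfl (fun i _ => hT i)]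
  obtain ⟨τ, hτ⟩ : ∃ τ : I → I, ∀ i, σ (τ i) = i ∧ τ (σ i) = i := ⟨σ.symm, by simp⟩
  generalize hs : (σ : I → I) = s at *
  have W := fun i => And.intro (hF i) (And.intro (hT i) (And.intro (hF (s i)) (hT (τ i))))
  have e := fun i => hτ i
  simp only [(hτ _).1] at W
  have Wx : ∀ i, x = some i → _ := fun i _ => W i
  have Wx' : ∀ i, x' = some i → _ := fun i _ => W i
  have Wy : ∀ i, y = some i → _ := fun i _ => W i
  have Wy' : ∀ i, y' = some i → _ := fun i _ => W i
  have Wz : ∀ i b, z = some (i, b) → _ := fun i b _ => W i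
  have Wz' : ∀ i b, z' = some (i, b) → _ := fun i b _ => W i
  clear W hF hT e hs
  rcases x with _ | x <;> rcases y with _ | y <;> rcases z with _ | ⟨z, zb⟩ <;>
  rcases x' with _ | x' <;> rcases y' with _ | y' <;> rcases z' with _ | ⟨z', zb'⟩ <;>
  simp [cnt] at hc
  all_goals
    simp only [reduceCtorEq, if_false, Option.some.injEq, Prod.mk.injEq, and_true, and_false, Nat.zero_add, Nat.add_zero, false_and, exists_false, or_false, false_or, true_and,exists_and_left, exists_and_right, exists_eq', exists_eq_left', and_self, or_true, true_or, exists_eq, forall_eq', if_true, Bool.false_eq_true, Bool.true_eq_false, forall_const, implies_true, IsEmpty.forall_iff, and_imp] at Wx Wx' Wy Wy' Wz Wz' ⊢ 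
  all_goals try grind
  all_goals
    by_cases hI : Subsingleton I
    · have e1 := hI.elim x x'
      have e2 := hI.elim y y'
      first
      | exact ⟨e1, e2⟩
      | have e3 := hI.elim z z'
        subst e1 e2 e3
        have e4 := hI.elim x y
        have e5 := hI.elim x z
        subst e4 e5
        have e6 := hI.elim (s x) x
        have e7 := hI.elim (τ x) x
        cases zb <;> cases zb' <;> simp_all
    · have hσ' : ∀ i, s i ≠ i := fun i hi => hI (hσ i hi)
      have e1 := hσ' x
      have e2 := hσ' y
      first
      | done
      | grind
      | clear hσ' hσ hc
        have Vz := Wz z zb rfl rfl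
        have Vz' := Wz' z' zb' rfl rfl
        clear Wz Wz'
        cases zb <;> cases zb' <;> simp only [Bool.false_eq_true, Bool.true_eq_false, and_true, and_false, if_false, Nat.add_zero, reduceCtorEq] at * <;> grind (splits := 30)


section construction
variable {I J K T E : Type} [Fintype I] [DecidableEq I] [Fintype J] [DecidableEq J]
  [Fintype K] [DecidableEq K] [DecidableEq T] [DecidableEq E]

/-- first coordinates -/
abbrev BlA (I J K T : Type) := I ⊕ J ⊕ (K × Bool) ⊕ (T × Bool)
/-- second coordinates -/
abbrev BlB (I J K T : Type) := I ⊕ (J × Bool) ⊕ K ⊕ (T × Bool)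
/-- third coordinates; `E` is for the possible value never asked -/
abbrev BlC (I J K T E : Type) := (I × Bool) ⊕ J ⊕ K ⊕ (T × Bool) ⊕ E
/-- indices of the questions -/
abbrev BlV (I J K T : Type) := (I × Bool) ⊕ (J × Bool) ⊕ (K × Bool) ⊕ (T × Fin 3)

def qA : BlV I J K T → BlA I J K T
  | .inl v => .inl v.1
  | .inr (.inl v) => .inr (.inl v.1)
  | .inr (.inr (.inl v)) => .inr (.inr (.inl v))
  | .inr (.inr (.inr v)) => .inr (.inr (.inr (v.1, v.2 == 0)))

def qB (σ : Equiv.Perm I) : BlV I J K T → BlB I J K T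
  | .inl v => .inl (if v.2 then σ v.1 else v.1)
  | .inr (.inl v) => .inr (.inl v)
  | .inr (.inr (.inl v)) => .inr (.inr (.inl v.1))
  | .inr (.inr (.inr v)) => .inr (.inr (.inr (v.1, v.2 == 1)))

def qC (ρ : Equiv.Perm J) (θ : Equiv.Perm K) : BlV I J K T → BlC I J K T E
  | .inl v => .inl v
  | .inr (.inl v) => .inr (.inl (if v.2 then ρ v.1 else v.1))
  | .inr (.inr (.inl v)) => .inr (.inr (.inl (if v.2 then θ v.1 else v.1)))
  | .inr (.inr (.inr v)) => .inr (.inr (.inr (.inl (v.1, v.2 == 2))))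

def p1 {α β : Type} : α ⊕ β → Option α
  | .inl a => some a
  | _ => none
def p2 {α β γ : Type} : α ⊕ β ⊕ γ → Option β
  | .inr (.inl a) => some a
  | _ => none
def p3 {α β γ δ : Type} : α ⊕ β ⊕ γ ⊕ δ → Option γ
  | .inr (.inr (.inl a)) => some a
  | _ => none

theorem p1_iff {α β : Type} (x : α ⊕ β) (a : α) : x = .inl a ↔ p1 x = some a := by
  rcases x with x | x <;> simp [p1]
theorem p2_iff {α β γ : Type} (x : α ⊕ β ⊕ γ) (a : β) : x = .inr (.inl a) ↔ p2 x = some a := by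
  rcases x with x | x | x <;> simp [p2]
theorem p3_iff {α β γ δ : Type} (x : α ⊕ β ⊕ γ ⊕ δ) (a : γ) :
    x = .inr (.inr (.inl a)) ↔ p3 x = some a := by
  rcases x with x | x | x | x <;> simp [p3]

set_option maxHeartbeats 4000000 in
theorem construction_resolves (σ : Equiv.Perm I) (ρ : Equiv.Perm J) (θ : Equiv.Perm K)
    (hσ : ∀ i, σ i = i → Subsingleton I) (hρ : ∀ i, ρ i = i → Subsingleton J)
    (hθ : ∀ i, θ i = i → Subsingleton K) (hT : Subsingleton T) (hE : Subsingleton E)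
    (hex : ¬ ((Nonempty I ∧ Subsingleton I) ∧ (Nonempty J ∧ Subsingleton J) ∧
      (Nonempty K ∧ Subsingleton K)))
    (hex2 : ¬ (Nonempty T ∧ Nonempty E ∧ Nonempty I ∧ Subsingleton I))
    (x x' : BlA I J K T) (y y' : BlB I J K T) (z z' : BlC I J K T E)
    (h : ∀ v, (if x = qA v then 1 else 0) + (if y = qB σ v then 1 else 0)
        + (if z = qC ρ θ v then 1 else 0) =
      (if x' = qA v then 1 else 0) + (if y' = qB σ v then 1 else 0)
        + (if z' = qC ρ θ v then 1 else 0)) :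
    x = x' ∧ y = y' ∧ z = z' := by
  have H1 := comp_lemma σ (p1 x) (p1 x') (p1 y) (p1 y') (p1 z) (p1 z') (by
    intro i b
    simpa only [qA, qB, qC, p1_iff] using h (.inl (i, b))) hσ
  have H2 := comp_lemma ρ (p2 x) (p2 x') (p2 z) (p2 z') (p2 y) (p2 y') (by
    intro i b
    have := h (.inr (.inl (i, b)))
    simp only [qA, qB, qC, p2_iff] at this
    omega) hρ
  have H3 := comp_lemma θ (p3 y) (p3 y') (p3 z) (p3 z') (p3 x) (p3 x') (by
    intro i b
    have := h (.inr (.inr (.inl (i, b))))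
    simp only [qA, qB, qC, p3_iff] at this
    omega) hθ
  have h0 : ∀ u, _ := fun u => h (.inr (.inr (.inr (u, 0))))
  have h1 : ∀ u, _ := fun u => h (.inr (.inr (.inr (u, 1))))
  have h2 : ∀ u, _ := fun u => h (.inr (.inr (.inr (u, 2))))
  clear h hσ hρ hθ
  have hu : ∀ u v : T, (u = v) = True := fun u v => by simp [hT.elim u v]
  have hv : ∀ u v : E, (u = v) = True := fun u v => by simp [hE.elim u v]
  simp only [qA, qB, qC] at h0 h1 h2
  rcases x with x | x | x | ⟨u, x⟩ <;> rcases x' with x' | x' | x' | ⟨u', x'⟩ <;>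
    simp [p1, p2, p3] at H1 H2 H3 <;>
  rcases y with y | y | y | ⟨v, y⟩ <;> rcases y' with y' | y' | y' | ⟨v', y'⟩ <;>
    simp at H1 H2 H3 <;>
  rcases z with z | z | z | ⟨w, z⟩ | z <;> rcases z' with z' | z' | z' | ⟨w', z'⟩ | z' <;>
    simp at H1 H2 H3
  all_goals try simp only [H1, H2, H3, hu, hv, and_self, true_and, and_true, Sum.inl.injEq, Sum.inr.injEq, Prod.mk.injEq, reduceCtorEq, false_and, and_false]
  all_goals try (exfalso; apply hex; refine ⟨⟨⟨?_⟩, ?_⟩, ⟨⟨?_⟩, ?_⟩, ⟨⟨?_⟩, ?_⟩⟩ <;> assumption; done)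
  all_goals try (exfalso; apply hex2; refine ⟨⟨?_⟩, ⟨?_⟩, ⟨?_⟩, ?_⟩ <;> assumption; done)
  all_goals
    have t : T := by assumption
    replace h0 := h0 t
    replace h1 := h1 t
    replace h2 := h2 t
    simp [hu] at h0 h1 h2
  all_goals try clear H1
  all_goals try clear H2
  all_goals try clear H3
  all_goals clear hu hv hex hex2
  all_goals try revert h0
  all_goals try revert h1
  all_goals try revert h2
  all_goals try cases x
  all_goals try cases y
  all_goals try cases z
  all_goals try cases x'
  all_goals try cases y'
  all_goals try cases z'
  all_goals try decide
end construction

theorem f_le_of {a b c n : ℕ} {A B C V : Type} [Fintype A] [Fintype B] [Fintype C] [Fintype V]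
    [DecidableEq A] [DecidableEq B] [DecidableEq C]
    (hA : Fintype.card A = a) (hB : Fintype.card B = b) (hC : Fintype.card C = c)
    (hV : Fintype.card V = n) (qa : V → A) (qb : V → B) (qc : V → C)
    (hres : ∀ x x' y y' z z', (∀ v, (if x = qa v then 1 else 0) + (if y = qb v then 1 else 0)
        + (if z = qc v then 1 else 0) =
      (if x' = qa v then 1 else 0) + (if y' = qb v then 1 else 0)
        + (if z' = qc v then 1 else 0)) → x = x' ∧ y = y' ∧ z = z') : f a b c ≤ n := by
  classical
  let eA := Fintype.equivFinOfCardEq hA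
  let eB := Fintype.equivFinOfCardEq hB
  let eC := Fintype.equivFinOfCardEq hC
  let Q : Finset (Question a b c) :=
    Finset.univ.image (fun v : V => (eA (qa v), eB (qb v), eC (qc v)))
  have hQ : Feasible Q := by
    rintro ⟨x, y, z⟩ ⟨x', y', z'⟩ hne
    by_contra hcon
    push Not at hcon
    apply hne
    have := hres (eA.symm x) (eA.symm x') (eB.symm y) (eB.symm y') (eC.symm z) (eC.symm z') (by
      intro v
      have h := hcon _ (Finset.mem_image_of_mem _ (Finset.mem_univ v))
      simpa only [g, Equiv.symm_apply_eq] using h)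
    simpa using this
  calc f a b c ≤ Q.card := Nat.sInf_le ⟨Q, hQ, rfl⟩
    _ ≤ Finset.univ.card := Finset.card_image_le
    _ = n := hV

theorem finRotate_fix (p : ℕ) (i : Fin p) (h : finRotate p i = i) : Subsingleton (Fin p) := by
  rcases p with _ | _ | p
  · exact Fin.subsingleton_iff_le_one.2 (by omega)
  · exact Fin.subsingleton_iff_le_one.2 (by omega)
  · rw [finRotate_apply] at h
    simp at h

theorem f_le_construction (p q r t e : ℕ) (ht : t ≤ 1) (he : e ≤ 1)
    (h1 : ¬ (p = 1 ∧ q = 1 ∧ r = 1)) (h2 : ¬ (t = 1 ∧ e = 1 ∧ p = 1)) {a b c n : ℕ}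
    (ha : a = p + q + 2 * r + 2 * t) (hb : b = p + 2 * q + r + 2 * t)
    (hc : c = 2 * p + q + r + 2 * t + e) (hn : n = 2 * (p + q + r) + 3 * t) :
    f a b c ≤ n ∧ f a c b ≤ n ∧ f c b a ≤ n := by
  have sub : ∀ m, (Nonempty (Fin m) ∧ Subsingleton (Fin m)) → m = 1 := by
    rintro m ⟨⟨i⟩, hs⟩
    have := Fin.subsingleton_iff_le_one.1 hs
    have := i.pos
    omega
  have hres := construction_resolves (I := Fin p) (J := Fin q) (K := Fin r) (T := Fin t)
    (E := Fin e) (finRotate p) (finRotate q) (finRotate r) (finRotate_fix p) (finRotate_fix q)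
    (finRotate_fix r) (Fin.subsingleton_iff_le_one.2 ht) (Fin.subsingleton_iff_le_one.2 he)
    (fun h => h1 ⟨sub _ h.1, sub _ h.2.1, sub _ h.2.2⟩)
    (fun h => h2 ⟨sub _ ⟨h.1, Fin.subsingleton_iff_le_one.2 ht⟩,
      sub _ ⟨h.2.1, Fin.subsingleton_iff_le_one.2 he⟩, sub _ h.2.2⟩)
  have cA : Fintype.card (BlA (Fin p) (Fin q) (Fin r) (Fin t)) = a := by
    simp; omega
  have cB : Fintype.card (BlB (Fin p) (Fin q) (Fin r) (Fin t)) = b := by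
    simp; omega
  have cC : Fintype.card (BlC (Fin p) (Fin q) (Fin r) (Fin t) (Fin e)) = c := by
    simp; omega
  have cV : Fintype.card (BlV (Fin p) (Fin q) (Fin r) (Fin t)) = n := by
    simp; omega
  refine ⟨f_le_of cA cB cC cV _ _ _ hres, f_le_of cA cC cB cV qA (qC (finRotate q) (finRotate r))
    (qB (finRotate p)) ?_, f_le_of cC cB cA cV (qC (finRotate q) (finRotate r))
    (qB (finRotate p)) qA ?_⟩
  · intro x x' z z' y y' h
    have := hres x x' y y' z z' (fun v => by have := h v; omega)
    tauto
  · intro z z' y y' x x' h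
    have := hres x x' y y' z z' (fun v => by have := h v; omega)
    tauto

/-- base-4 code of the vector of answers to a secret -/
def ansCode (Q : List (ℕ × ℕ × ℕ)) (x y z : ℕ) : ℕ :=
  Q.foldr (fun q acc => 4 * acc + ((if x = q.1 then 1 else 0) + (if y = q.2.1 then 1 else 0) +
    (if z = q.2.2 then 1 else 0))) 0

/-- linear-time duplicate check with a bit mask -/
def noDup : List ℕ → ℕ → Bool
  | [], _ => true
  | h :: t, mask => !(mask.testBit h) && noDup t (mask ||| (1 <<< h))

theorem noDup_spec (l : List ℕ) : ∀ mask, noDup l mask = true →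
    l.Nodup ∧ ∀ h ∈ l, mask.testBit h = false := by
  induction l with
  | nil => simp
  | cons h t ih =>
    intro mask hm
    simp only [noDup, Bool.and_eq_true, Bool.not_eq_true'] at hm
    obtain ⟨h1, h2⟩ := ih _ hm.2
    simp only [Nat.testBit_or, Bool.or_eq_false_iff] at h2
    refine ⟨List.nodup_cons.2 ⟨fun hh => ?_, h1⟩, ?_⟩
    · have := (h2 h hh).2
      simp [Nat.one_shiftLeft, Nat.testBit_two_pow_self] at this
    · intro k hk
      rcases List.mem_cons.1 hk with rfl | hk
      · exact hm.1
      · exact (h2 k hk).1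

theorem f_le_of_code (a b c n M : ℕ) (Q : List (ℕ × ℕ × ℕ)) (hl : Q.length = n)
    (hQ : ∀ q ∈ Q, q.1 < a ∧ q.2.1 < b ∧ q.2.2 < c)
    (hnd : noDup (((List.range a).product ((List.range b).product (List.range c))).map
      (fun s => ansCode Q s.1 s.2.1 s.2.2 % M)) 0 = true) : f a b c ≤ n := by
  have hinj := List.inj_on_of_nodup_map (noDup_spec _ _ hnd).1
  have cd : ∀ x y z x' y' z', (∀ q ∈ Q, ((if x = q.1 then 1 else 0) + (if y = q.2.1 then 1 else 0) +
      (if z = q.2.2 then 1 else 0)) = ((if x' = q.1 then 1 else 0) +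
      (if y' = q.2.1 then 1 else 0) + (if z' = q.2.2 then 1 else 0))) →
      ansCode Q x y z = ansCode Q x' y' z' := by
    intro x y z x' y' z' h
    unfold ansCode
    clear hnd hinj hQ hl
    induction Q with
    | nil => rfl
    | cons q Q ih =>
      simp only [List.foldr_cons]
      rw [ih (fun q' hq' => h q' (List.mem_cons_of_mem _ hq')), h q List.mem_cons_self]
  have lt : ∀ v : Fin n, _ := fun v => hQ (Q[v.1]'(hl ▸ v.2)) (List.getElem_mem _)
  refine f_le_of (V := Fin n) (Fintype.card_fin a) (Fintype.card_fin b) (Fintype.card_fin c)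
    (Fintype.card_fin n) (fun v => ⟨_, (lt v).1⟩) (fun v => ⟨_, (lt v).2.1⟩)
    (fun v => ⟨_, (lt v).2.2⟩) ?_
  intro x x' y y' z z' h
  have e := cd x y z x' y' z' (by
    intro q hq
    obtain ⟨i, hi, rfl⟩ := List.mem_iff_getElem.1 hq
    have := h ⟨i, hl ▸ hi⟩
    simpa only [Fin.ext_iff] using this)
  have := @hinj (x.1, y.1, z.1) (by simp [List.mem_product]) (x'.1, y'.1, z'.1)
    (by simp [List.mem_product]) (congrArg (· % M) e)
  simpa [Fin.ext_iff] using this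

theorem f444 : f 4 4 4 ≤ 6 := f_le_of_code _ _ _ _ 289
  [(2,3,3),(1,2,0),(0,0,0),(0,1,2),(1,0,1),(3,1,1)] rfl (by decide) (by decide +kernel)
theorem f666 : f 6 6 6 ≤ 9 := f_le_of_code _ _ _ _ 1907
  [(0,1,0),(0,2,1),(5,3,0),(0,4,3),(1,4,5),(4,0,1),(0,1,4),(4,3,2),(3,1,2)] rfl (by decide)
  (by decide +kernel)
theorem f335 : f 3 3 5 ≤ 5 := f_le_of_code _ _ _ _ 95
  [(0,1,1),(0,0,0),(1,2,2),(2,1,4),(1,0,3)] rfl (by decide) (by decide +kernel)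
theorem f577 : f 5 7 7 ≤ 9 := f_le_of_code _ _ _ _ 2685
  [(2,0,4),(1,0,1),(3,5,0),(1,3,6),(4,3,3),(2,1,2),(0,2,3),(3,1,3),(0,6,0)] rfl (by decide)
  (by decide +kernel)
theorem f999 : f 9 9 9 ≤ 13 := f_le_of_code _ _ _ _ 21774
  [(0,6,7),(0,3,1),(1,7,8),(5,8,3),(5,4,2),(3,6,6),(6,7,0),(8,1,0),(8,0,3),(7,2,2),(3,3,4),
    (4,6,8),(7,3,5)] rfl (by decide) (by decide +kernel)

theorem f111 : f 1 1 1 ≤ 1 := f_le_of_code _ _ _ _ 64 [(0,0,0)] rfl (by decide) (by decide +kernel)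

set_option maxHeartbeats 2000000 in
theorem f_upper_bound_3a_ge (a b c : ℕ) (ha : 0 < a) (hab : a ≤ b) (hbc : b ≤ c)
    (h3a : b + c ≤ 3 * a) :
    f a b c ≤ (a + b + c) / 2 := by
  obtain ⟨n, hn⟩ : ∃ n, n = (a + b + c) / 2 := ⟨_, rfl⟩
  rw [← hn]
  obtain ⟨t, ht⟩ : ∃ t, t = n % 2 := ⟨_, rfl⟩
  obtain ⟨m, hm⟩ : ∃ m, n + t = 2 * m := ⟨(n + t) / 2, by omega⟩
  rcases Nat.mod_two_eq_zero_or_one (a + b + c) with hev | hodd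
  · -- even total
    by_cases hx : c - m = 1 ∧ b - m = 1 ∧ a - m = 1
    · have : (a = 4 ∧ b = 4 ∧ c = 4 ∧ n = 6) ∨ (a = 6 ∧ b = 6 ∧ c = 6 ∧ n = 9) := by omega
      rcases this with ⟨rfl, rfl, rfl, h⟩ | ⟨rfl, rfl, rfl, h⟩
      · rw [h]; exact f444
      · rw [h]; exact f666
    · exact (f_le_construction (c - m) (b - m) (a - m) t 0 (by omega) (by omega) hx (by omega)
        (by omega) (by omega) (by omega) (by omega)).1
  · by_cases h1 : c = 1
    · obtain ⟨rfl, rfl, rfl⟩ : a = 1 ∧ b = 1 ∧ c = 1 := by omega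
      rw [hn]; exact f111
    by_cases hx : (c - 1 - m = 1 ∧ b - m = 1 ∧ a - m = 1) ∨ (t = 1 ∧ c - 1 - m = 1)
    · by_cases hy : b - m = 1
      · -- decrement b instead
        exact (f_le_construction (b - 1 - m) (c - m) (a - m) t 1 (by omega) (by omega) (by omega)
          (by omega) (by omega) (by omega) (by omega) (by omega)).2.1
      · by_cases hz : a - m = 1
        · -- decrement a instead
          exact (f_le_construction (a - 1 - m) (b - m) (c - m) t 1 (by omega) (by omega)
            (by omega) (by omega) (by omega) (by omega) (by omega) (by omega)).2.2
        · have : (a = 3 ∧ b = 3 ∧ c = 5 ∧ n = 5) ∨ (a = 5 ∧ b = 7 ∧ c = 7 ∧ n = 9) ∨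
              (a = 9 ∧ b = 9 ∧ c = 9 ∧ n = 13) := by
            have ht1 : t = 1 := by
              rcases hx with hx | hx
              · exact absurd hx.2.1 hy
              · exact hx.1
            have hc2 : c = m + 2 := by
              rcases hx with hx | hx
              · exact absurd hx.2.1 hy
              · have := hx.2
                omega
            clear hx ht
            have hs : a + b + c = 2 * n + 1 := by omega
            clear hn hodd
            subst ht1 hc2
            obtain ⟨r, rfl⟩ : ∃ r, a = m + r := ⟨a - m, by omega⟩
            obtain ⟨q, rfl⟩ : ∃ q, b = m + q := ⟨b - m, by omega⟩
            have hr : r = 0 ∨ r = 2 := by omega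
            have hq : q = 0 ∨ q = 2 := by omega
            rcases hr with rfl | rfl <;> rcases hq with rfl | rfl <;> omega
          rcases this with ⟨rfl, rfl, rfl, h⟩ | ⟨rfl, rfl, rfl, h⟩ | ⟨rfl, rfl, rfl, h⟩
          · rw [h]; exact f335
          · rw [h]; exact f577
          · rw [h]; exact f999
    · exact (f_le_construction (c - 1 - m) (b - m) (a - m) t 1 (by omega) (by omega) (by omega)
        (by omega) (by omega) (by omega) (by omega) (by omega)).1
end

section
/- For all positive integers a, b, c with a ≤ b ≤ c, 3a = b + c and (a,b,c) ≠ (4,6,6), it holds that f(a,b,c) = ⌊(a+b+c)/2⌋ − 1. -/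
/-- the degree of a value `v` of the projection `π` in the question set `Q` -/
def dg {T I : Type*} [DecidableEq T] (Q : Finset I) (π : I → T) (v : T) : ℕ :=
  (Q.filter (fun q => π q = v)).card

lemma count_part {T I : Type*} [DecidableEq T] [Fintype T] (Q : Finset I) (π : I → T) :
    2 * Fintype.card T ≤ Q.card + 2 * (Finset.univ.filter (fun v => dg Q π v = 0)).card
      + (Q.filter (fun q => dg Q π (π q) = 1)).card := by
  classical
  have h1 : Q.card = ∑ v : T, dg Q π v :=
    Finset.card_eq_sum_card_fiberwise (f := π) (t := Finset.univ) (by intro x _; simp)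
  have h2 : (Q.filter (fun q => dg Q π (π q) = 1)).card
      = ∑ v : T, (if dg Q π v = 1 then 1 else 0) := by
    rw [Finset.card_eq_sum_card_fiberwise (f := π) (t := Finset.univ) (by intro x _; simp)]
    refine Finset.sum_congr rfl fun v _ => ?_
    rw [Finset.filter_filter]
    split_ifs with h
    · refine Eq.trans ?_ h
      conv_rhs => unfold dg
      congr 1
      ext q
      simp only [Finset.mem_filter]
      constructor
      · rintro ⟨h1, h2, h3⟩; exact ⟨h1, h3⟩
      · rintro ⟨h1, h3⟩; subst h3; exact ⟨h1, h, rfl⟩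
    · rw [Finset.card_eq_zero, Finset.filter_eq_empty_iff]
      rintro q _ ⟨h3, h4⟩
      subst h4
      exact h h3
  have h3 : (Finset.univ.filter (fun v => dg Q π v = 0)).card
      = ∑ v : T, (if dg Q π v = 0 then 1 else 0) := by
    rw [Finset.card_filter]
  have h4 : 2 * Fintype.card T = ∑ _v : T, 2 := by simp [mul_comm]
  rw [h2, h3, h4]
  conv_rhs => rw [h1]
  rw [Finset.mul_sum, ← Finset.sum_add_distrib, ← Finset.sum_add_distrib]
  refine Finset.sum_le_sum fun v _ => ?_
  split_ifs <;> omega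

lemma count_three {I : Type*} [DecidableEq I] (Q SA SB SC : Finset I) (hA : SA ⊆ Q) (hB : SB ⊆ Q)
    (hC : SC ⊆ Q) : SA.card + SB.card + SC.card ≤
      Q.card + (SA ∩ SB).card + (SA ∩ SC).card + (SB ∩ SC).card := by
  have e1 := Finset.card_union_add_card_inter SA SB
  have e2 := Finset.card_union_add_card_inter (SA ∪ SB) SC
  have e3 : (SA ∪ SB) ∩ SC = (SA ∩ SC) ∪ (SB ∩ SC) := Finset.union_inter_distrib_right _ _ _
  have e4 : ((SA ∪ SB) ∩ SC).card ≤ (SA ∩ SC).card + (SB ∩ SC).card := by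
    rw [e3]; exact Finset.card_union_le _ _
  have e5 : ((SA ∪ SB) ∪ SC).card ≤ Q.card :=
    Finset.card_le_card (Finset.union_subset (Finset.union_subset hA hB) hC)
  omega

lemma dg_zero {T I : Type*} [DecidableEq T] {Q : Finset I} {π : I → T} {v : T}
    (h : dg Q π v = 0) {q : I} (hq : q ∈ Q) : ¬ v = π q := by
  unfold dg at h
  rw [Finset.card_eq_zero, Finset.filter_eq_empty_iff] at h
  exact fun h' => h hq h'.symm

lemma dg_one {T I : Type*} [DecidableEq T] {Q : Finset I} {π : I → T} {q r : I}
    (h : dg Q π (π q) = 1) (hq : q ∈ Q) (hr : r ∈ Q) : π q = π r ↔ q = r := by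
  unfold dg at h
  rw [Finset.card_eq_one] at h
  obtain ⟨w, hw⟩ := h
  constructor
  · intro h'
    have h1 : q ∈ ({w} : Finset I) := by rw [← hw]; simp [hq]
    have h2 : r ∈ ({w} : Finset I) := by rw [← hw]; simp [hr, h']
    simp at h1 h2
    rw [h1, h2]
  · rintro rfl; rfl

lemma lower {a b c : ℕ} (ha : 0 < a) (hb : 0 < b) (hc : 0 < c) (h3a : 3 * a = b + c)
    (Q : Finset (Question a b c)) (hQ : Feasible Q) : 2 * a - 1 ≤ Q.card := by
  classical
  let pA : Question a b c → Fin a := fun q => q.1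
  let pB : Question a b c → Fin b := fun q => q.2.1
  let pC : Question a b c → Fin c := fun q => q.2.2
  have cA := count_part Q pA
  have cB := count_part Q pB
  have cC := count_part Q pC
  set ZA := Finset.univ.filter (fun v => dg Q pA v = 0) with hZA
  set ZB := Finset.univ.filter (fun v => dg Q pB v = 0) with hZB
  set ZC := Finset.univ.filter (fun v => dg Q pC v = 0) with hZC
  set SA := Q.filter (fun q => dg Q pA (pA q) = 1) with hSA
  set SB := Q.filter (fun q => dg Q pB (pB q) = 1) with hSB
  set SC := Q.filter (fun q => dg Q pC (pC q) = 1) with hSC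
  have c3 := count_three Q SA SB SC (Finset.filter_subset _ _) (Finset.filter_subset _ _)
    (Finset.filter_subset _ _)
  simp only [Fintype.card_fin] at cA cB cC
  have zA : ZA.card ≤ 1 := by
    rw [Finset.card_le_one]
    intro v hv w hw
    simp only [hZA, Finset.mem_filter, Finset.mem_univ, true_and] at hv hw
    by_contra hne
    obtain ⟨q, hq, hg⟩ := hQ (v, ⟨0, hb⟩, ⟨0, hc⟩) (w, ⟨0, hb⟩, ⟨0, hc⟩) (by simpa using hne)
    have h1 : ¬ v = q.1 := dg_zero hv hq
    have h2 : ¬ w = q.1 := dg_zero hw hq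
    simp [g, h1, h2] at hg
  have zB : ZB.card ≤ 1 := by
    rw [Finset.card_le_one]
    intro v hv w hw
    simp only [hZB, Finset.mem_filter, Finset.mem_univ, true_and] at hv hw
    by_contra hne
    obtain ⟨q, hq, hg⟩ := hQ (⟨0, ha⟩, v, ⟨0, hc⟩) (⟨0, ha⟩, w, ⟨0, hc⟩) (by simpa using hne)
    have h1 : ¬ v = q.2.1 := dg_zero hv hq
    have h2 : ¬ w = q.2.1 := dg_zero hw hq
    simp [g, h1, h2] at hg
  have zC : ZC.card ≤ 1 := by
    rw [Finset.card_le_one]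
    intro v hv w hw
    simp only [hZC, Finset.mem_filter, Finset.mem_univ, true_and] at hv hw
    by_contra hne
    obtain ⟨q, hq, hg⟩ := hQ (⟨0, ha⟩, ⟨0, hb⟩, v) (⟨0, ha⟩, ⟨0, hb⟩, w) (by simpa using hne)
    have h1 : ¬ v = q.2.2 := dg_zero hv hq
    have h2 : ¬ w = q.2.2 := dg_zero hw hq
    simp [g, h1, h2] at hg
  have sAB : (SA ∩ SB).card ≤ 1 := by
    rw [Finset.card_le_one]
    intro v hv w hw
    simp only [hSA, hSB, Finset.mem_inter, Finset.mem_filter] at hv hw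
    obtain ⟨⟨v0, v1⟩, -, v2⟩ := hv
    obtain ⟨⟨w0, w1⟩, -, w2⟩ := hw
    by_contra hne
    obtain ⟨q, hq, hg⟩ := hQ (v.1, w.2.1, ⟨0, hc⟩) (w.1, v.2.1, ⟨0, hc⟩) (by
      intro h
      have h' : v.1 = w.1 := congrArg (fun s => s.1) h
      exact hne ((dg_one v1 v0 w0).1 h'))
    have e1 : v.1 = q.1 ↔ v = q := dg_one v1 v0 hq
    have e2 : v.2.1 = q.2.1 ↔ v = q := dg_one v2 v0 hq
    have e3 : w.1 = q.1 ↔ w = q := dg_one w1 w0 hq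
    have e4 : w.2.1 = q.2.1 ↔ w = q := dg_one w2 w0 hq
    apply hg
    simp only [g, e1, e2, e3, e4]
    ring
  have sAC : (SA ∩ SC).card ≤ 1 := by
    rw [Finset.card_le_one]
    intro v hv w hw
    simp only [hSA, hSC, Finset.mem_inter, Finset.mem_filter] at hv hw
    obtain ⟨⟨v0, v1⟩, -, v2⟩ := hv
    obtain ⟨⟨w0, w1⟩, -, w2⟩ := hw
    by_contra hne
    obtain ⟨q, hq, hg⟩ := hQ (v.1, ⟨0, hb⟩, w.2.2) (w.1, ⟨0, hb⟩, v.2.2) (by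
      intro h
      have h' : v.1 = w.1 := congrArg (fun s => s.1) h
      exact hne ((dg_one v1 v0 w0).1 h'))
    have e1 : v.1 = q.1 ↔ v = q := dg_one v1 v0 hq
    have e2 : v.2.2 = q.2.2 ↔ v = q := dg_one v2 v0 hq
    have e3 : w.1 = q.1 ↔ w = q := dg_one w1 w0 hq
    have e4 : w.2.2 = q.2.2 ↔ w = q := dg_one w2 w0 hq
    apply hg
    simp only [g, e1, e2, e3, e4]
    ring
  have sBC : (SB ∩ SC).card ≤ 1 := by
    rw [Finset.card_le_one]
    intro v hv w hw
    simp only [hSB, hSC, Finset.mem_inter, Finset.mem_filter] at hv hw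
    obtain ⟨⟨v0, v1⟩, -, v2⟩ := hv
    obtain ⟨⟨w0, w1⟩, -, w2⟩ := hw
    by_contra hne
    obtain ⟨q, hq, hg⟩ := hQ (⟨0, ha⟩, v.2.1, w.2.2) (⟨0, ha⟩, w.2.1, v.2.2) (by
      intro h; exact hne ((dg_one v1 v0 w0).1 (congrArg (fun s => s.2.1) h)))
    have e1 : v.2.1 = q.2.1 ↔ v = q := dg_one v1 v0 hq
    have e2 : v.2.2 = q.2.2 ↔ v = q := dg_one v2 v0 hq
    have e3 : w.2.1 = q.2.1 ↔ w = q := dg_one w1 w0 hq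
    have e4 : w.2.2 = q.2.2 ↔ w = q := dg_one w2 w0 hq
    apply hg
    simp only [g, e1, e2, e3, e4]
    ring
  have tAB : ZA.card = 0 ∨ ZB.card = 0 ∨ (SA ∩ SB).card = 0 := by
    by_contra! h
    obtain ⟨h1, h2, h3⟩ := h
    obtain ⟨x, hx⟩ := Finset.card_ne_zero.1 h1
    obtain ⟨y, hy⟩ := Finset.card_ne_zero.1 h2
    obtain ⟨v, hv⟩ := Finset.card_ne_zero.1 h3
    simp only [hZA, hZB, Finset.mem_filter, Finset.mem_univ, true_and] at hx hy
    simp only [hSA, hSB, Finset.mem_inter, Finset.mem_filter] at hv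
    obtain ⟨⟨v0, v1⟩, -, v2⟩ := hv
    obtain ⟨q, hq, hg⟩ := hQ (v.1, y, ⟨0, hc⟩) (x, v.2.1, ⟨0, hc⟩) (by
      intro h; exact dg_zero hx v0 (congrArg Prod.fst h).symm)
    have e1 : v.1 = q.1 ↔ v = q := dg_one v1 v0 hq
    have e2 : v.2.1 = q.2.1 ↔ v = q := dg_one v2 v0 hq
    have e3 : ¬ x = q.1 := dg_zero hx hq
    have e4 : ¬ y = q.2.1 := dg_zero hy hq
    apply hg
    simp only [g, e1, e2, e3, e4, if_false]
    ring
  have tAC : ZA.card = 0 ∨ ZC.card = 0 ∨ (SA ∩ SC).card = 0 := by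
    by_contra! h
    obtain ⟨h1, h2, h3⟩ := h
    obtain ⟨x, hx⟩ := Finset.card_ne_zero.1 h1
    obtain ⟨y, hy⟩ := Finset.card_ne_zero.1 h2
    obtain ⟨v, hv⟩ := Finset.card_ne_zero.1 h3
    simp only [hZA, hZC, Finset.mem_filter, Finset.mem_univ, true_and] at hx hy
    simp only [hSA, hSC, Finset.mem_inter, Finset.mem_filter] at hv
    obtain ⟨⟨v0, v1⟩, -, v2⟩ := hv
    obtain ⟨q, hq, hg⟩ := hQ (v.1, ⟨0, hb⟩, y) (x, ⟨0, hb⟩, v.2.2) (by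
      intro h; exact dg_zero hx v0 (congrArg Prod.fst h).symm)
    have e1 : v.1 = q.1 ↔ v = q := dg_one v1 v0 hq
    have e2 : v.2.2 = q.2.2 ↔ v = q := dg_one v2 v0 hq
    have e3 : ¬ x = q.1 := dg_zero hx hq
    have e4 : ¬ y = q.2.2 := dg_zero hy hq
    apply hg
    simp only [g, e1, e2, e3, e4, if_false]
    ring
  have tBC : ZB.card = 0 ∨ ZC.card = 0 ∨ (SB ∩ SC).card = 0 := by
    by_contra! h
    obtain ⟨h1, h2, h3⟩ := h
    obtain ⟨x, hx⟩ := Finset.card_ne_zero.1 h1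
    obtain ⟨y, hy⟩ := Finset.card_ne_zero.1 h2
    obtain ⟨v, hv⟩ := Finset.card_ne_zero.1 h3
    simp only [hZB, hZC, Finset.mem_filter, Finset.mem_univ, true_and] at hx hy
    simp only [hSB, hSC, Finset.mem_inter, Finset.mem_filter] at hv
    obtain ⟨⟨v0, v1⟩, -, v2⟩ := hv
    obtain ⟨q, hq, hg⟩ := hQ (⟨0, ha⟩, v.2.1, y) (⟨0, ha⟩, x, v.2.2) (by
      intro h; exact dg_zero hx v0 (congrArg (fun s => s.2.1) h).symm)
    have e1 : v.2.1 = q.2.1 ↔ v = q := dg_one v1 v0 hq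
    have e2 : v.2.2 = q.2.2 ↔ v = q := dg_one v2 v0 hq
    have e3 : ¬ x = q.2.1 := dg_zero hx hq
    have e4 : ¬ y = q.2.2 := dg_zero hy hq
    apply hg
    simp only [g, e1, e2, e3, e4, if_false]
    ring
  omega

/-- count of agreements of the triple `(x,y,z)` with question `(p,q,r)` over arbitrary types -/
def cnt {A B C : Type*} [DecidableEq A] [DecidableEq B] [DecidableEq C]
    (x : A) (y : B) (z : C) (p : A) (q : B) (r : C) : ℕ :=
  (if x = p then 1 else 0) + (if y = q then 1 else 0) + (if z = r then 1 else 0)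

lemma upper_of {a b c N : ℕ} (α : Fin N → Fin a) (β : Fin N → Fin b) (γ : Fin N → Fin c)
    (h : ∀ x y z x' y' z', (∀ i, cnt x y z (α i) (β i) (γ i) = cnt x' y' z' (α i) (β i) (γ i)) →
      x = x' ∧ y = y' ∧ z = z') : ∃ Q : Finset (Question a b c), Feasible Q ∧ Q.card ≤ N := by
  classical
  refine ⟨Finset.univ.image (fun i => (α i, β i, γ i)), ?_, ?_⟩
  · rintro ⟨x, y, z⟩ ⟨x', y', z'⟩ hne
    by_contra! hcon
    apply hne
    obtain ⟨h1, h2, h3⟩ := h x y z x' y' z' (fun i =>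
      hcon (α i, β i, γ i) (Finset.mem_image_of_mem _ (Finset.mem_univ i)))
    rw [h1, h2, h3]
  · refine Finset.card_image_le.trans ?_
    simp

section abs
variable {I A B C : Type*} [DecidableEq A] [DecidableEq B] [DecidableEq C]

/-- the case `x ≠ x'` in the generic construction where both blocks are pairs -/
lemma abs_pp (α : I → A) (β : I → B) (γ : I → C) (sA sB sC : I → I) (t : I)
    (hα : ∀ i j, α i = α j ↔ j = i ∨ j = sA i)
    (hβ : ∀ i j, β i = β j ↔ j = i ∨ j = sB i)
    (hγ : ∀ i j, γ i = γ j ↔ j = i ∨ j = sC i)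
    (hAB : ∀ i, sA i ≠ sB i) (hAC : ∀ i, sA i ≠ sC i)
    (hty : ∀ i, i ≠ t → (sB i = i ↔ sC i ≠ i))
    (hmix : ∀ i, i ≠ t → sC i = i → sC (sA i) ≠ sA i → i = sB t)
    (hmix' : sC (sA (sB t)) ≠ sA (sB t))
    (p r : I) (hp : p ≠ t) (hp2 : sA p ≠ t) (hr : r ≠ t) (hr2 : sA r ≠ t)
    (x x' : A) (y y' : B) (z z' : C) (hx : x = α p) (hx' : x' = α r) (hne : x ≠ x')
    (hy' : y' = β p) (hz' : z' = γ (sA p)) (hy : y = β r) (hz : z = γ (sA r))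
    (H : ∀ i, cnt x y z (α i) (β i) (γ i) = cnt x' y' z' (α i) (β i) (γ i)) : False := by
  have iB : ∀ i, sB (sB i) = i := fun i => by
    have h1 := (hβ i (sB i)).2 (Or.inr rfl)
    have h2 := (hβ (sB i) i).1 h1.symm
    grind
  have iC : ∀ i, sC (sC i) = i := fun i => by
    have h1 := (hγ i (sC i)).2 (Or.inr rfl)
    have h2 := (hγ (sC i) i).1 h1.symm
    grind
  have iA : ∀ i, sA (sA i) = i := fun i => by
    have h1 := (hα i (sA i)).2 (Or.inr rfl)
    have h2 := (hα (sA i) i).1 h1.symm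
    grind
  subst hx hx' hy hy' hz hz'
  simp only [cnt, hα, hβ, hγ] at H hne
  have H1 := H p
  have H2 := H (sA p)
  have H3 := H r
  have H4 := H (sA r)
  have H5 := H (sB p)
  have H6 := H (sC (sA p))
  have H7 := H (sB r)
  have H8 := H (sC (sA r))
  have T1 := hty p hp
  have T2 := hty _ hp2
  have T3 := hty r hr
  have T4 := hty _ hr2
  have M1 := hmix p hp
  have M2 := hmix _ hp2
  have M3 := hmix r hr
  have M4 := hmix _ hr2
  have T5 := hty (sB p)
  have T6 := hty (sC (sA p))
  have T7 := hty (sB r)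
  have T8 := hty (sC (sA r))
  by_cases c1 : sC p = p <;> by_cases c2 : sC (sA p) = sA p <;>
  by_cases c3 : sC r = r <;> by_cases c4 : sC (sA r) = sA r
  all_goals grind


/-- the case `x ≠ x'` in the generic construction where the first block is `{t}` -/
lemma abs_tp (α : I → A) (β : I → B) (γ : I → C) (sA sB sC : I → I) (t : I)
    (hα : ∀ i j, α i = α j ↔ j = i ∨ j = sA i)
    (hβ : ∀ i j, β i = β j ↔ j = i ∨ j = sB i)
    (hγ : ∀ i j, γ i = γ j ↔ j = i ∨ j = sC i)
    (hAt : sA t = t)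
    (hBt : sB t ≠ t) (hCt : sC t ≠ t) (hBCt : sB t ≠ sC t)
    (hAB : ∀ i, sA i ≠ sB i) (hAC : ∀ i, sA i ≠ sC i)
    (hty : ∀ i, i ≠ t → (sB i = i ↔ sC i ≠ i))
    (hmix : ∀ i, i ≠ t → sC i = i → sC (sA i) ≠ sA i → i = sB t)
    (hmix' : sC (sA (sB t)) ≠ sA (sB t))
    (r : I) (hr : r ≠ t) (hr2 : sA r ≠ t)
    (x x' : A) (y y' : B) (z z' : C) (hx : x = α t) (hx' : x' = α r)
    (hy' : y' = β t ∨ z' = γ t) (hy : y = β r) (hz : z = γ (sA r))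
    (H : ∀ i, cnt x y z (α i) (β i) (γ i) = cnt x' y' z' (α i) (β i) (γ i)) : False := by
  have iB : ∀ i, sB (sB i) = i := fun i => by
    have h1 := (hβ i (sB i)).2 (Or.inr rfl)
    have h2 := (hβ (sB i) i).1 h1.symm
    grind
  have iC : ∀ i, sC (sC i) = i := fun i => by
    have h1 := (hγ i (sC i)).2 (Or.inr rfl)
    have h2 := (hγ (sC i) i).1 h1.symm
    grind
  have iA : ∀ i, sA (sA i) = i := fun i => by
    have h1 := (hα i (sA i)).2 (Or.inr rfl)
    have h2 := (hα (sA i) i).1 h1.symm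
    grind
  subst hx hx' hy hz
  have T3 := hty r hr
  have T4 := hty _ hr2
  have M3 := hmix r hr
  have M4 := hmix _ hr2
  have T5 := hty _ hBt
  have T6 := hty _ hCt
  have T7 := hty (sB r)
  have T8 := hty (sC (sA r))
  have H0 := H t
  have H3 := H r
  have H4 := H (sA r)
  have H5 := H (sB t)
  have H6 := H (sC t)
  have H7 := H (sB r)
  have H8 := H (sC (sA r))
  rcases hy' with hy' | hy'
  · subst hy'
    simp only [cnt, hα, hβ, hγ] at H0 H3 H4 H5 H6 H7 H8
    by_cases c3 : sC r = r <;> by_cases c4 : sC (sA r) = sA r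
    all_goals grind
  · subst hy'
    simp only [cnt, hα, hβ, hγ] at H0 H3 H4 H5 H6 H7 H8
    by_cases c3 : sC r = r <;> by_cases c4 : sC (sA r) = sA r
    all_goals grind

lemma abs_yz (β : I → B) (γ : I → C) (sB sC : I → I)
    (hβ : ∀ i j, β i = β j ↔ j = i ∨ j = sB i)
    (hγ : ∀ i j, γ i = γ j ↔ j = i ∨ j = sC i)
    (hBC : ∀ i, sB i ≠ sC i)
    (hβs : ∀ y y', (∀ i, y ≠ β i) → (∀ i, y' ≠ β i) → y = y')
    (hγs : ∀ y y', (∀ i, y ≠ γ i) → (∀ i, y' ≠ γ i) → y = y')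
    (y y' : B) (z z' : C)
    (H : ∀ i, (if y = β i then 1 else 0) + (if z = γ i then 1 else 0)
      = (if y' = β i then 1 else 0) + (if z' = γ i then 1 else 0)) : y = y' ∧ z = z' := by
  have hz : ∀ z z', (∀ i, (if z = γ i then 1 else 0) = (if z' = γ i then 1 else 0)) → z = z' := by
    intro z z' H
    by_contra hne
    by_cases h1 : ∃ i, z = γ i
    · obtain ⟨i, hi⟩ := h1
      have := H i
      grind
    · by_cases h2 : ∃ i, z' = γ i
      · obtain ⟨i, hi⟩ := h2
        have := H i
        grind
      · push Not at h1 h2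
        exact hne (hγs z z' h1 h2)
  have key : ∀ y y' z z', (∀ i, (if y = β i then 1 else 0) + (if z = γ i then 1 else 0)
      = (if y' = β i then 1 else 0) + (if z' = γ i then 1 else 0)) → y ≠ y' →
      ∀ i, y ≠ β i := by
    intro y y' z z' H hne i hi
    have H1 := H i
    have H2 := H (sB i)
    have H3 := H (sC i)
    have e1 := (hβ i (sB i))
    have e2 := (hγ i (sB i))
    have e3 := (hβ i (sC i))
    have e4 := (hγ i (sC i))
    have e5 := hBC i
    grind
  by_cases hy : y = y'
  · subst hy
    refine ⟨rfl, hz z z' fun i => ?_⟩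
    have := H i
    omega
  · exfalso
    exact hy (hβs y y' (key y y' z z' H hy) (key y' y z' z (fun i => (H i).symm) (Ne.symm hy)))

lemma abs_main (α : I → A) (β : I → B) (γ : I → C) (sA sB sC : I → I) (t : I)
    (hα : ∀ i j, α i = α j ↔ j = i ∨ j = sA i)
    (hβ : ∀ i j, β i = β j ↔ j = i ∨ j = sB i)
    (hγ : ∀ i j, γ i = γ j ↔ j = i ∨ j = sC i)
    (hαs : ∀ x, ∃ i, x = α i)
    (hβs : ∀ y y', (∀ i, y ≠ β i) → (∀ i, y' ≠ β i) → y = y')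
    (hγs : ∀ y y', (∀ i, y ≠ γ i) → (∀ i, y' ≠ γ i) → y = y')
    (hAt : sA t = t)
    (hBt : sB t ≠ t) (hCt : sC t ≠ t)
    (hAB : ∀ i, sA i ≠ sB i) (hAC : ∀ i, sA i ≠ sC i) (hBC : ∀ i, sB i ≠ sC i)
    (hty : ∀ i, i ≠ t → (sB i = i ↔ sC i ≠ i))
    (hmix : ∀ i, i ≠ t → sC i = i → sC (sA i) ≠ sA i → i = sB t)
    (hmix' : sC (sA (sB t)) ≠ sA (sB t))
    (x : A) (y : B) (z : C) (x' : A) (y' : B) (z' : C)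
    (H : ∀ i, cnt x y z (α i) (β i) (γ i) = cnt x' y' z' (α i) (β i) (γ i)) :
    x = x' ∧ y = y' ∧ z = z' := by
  have iA : ∀ i, sA (sA i) = i := fun i => by
    have h1 := (hα i (sA i)).2 (Or.inr rfl)
    have h2 := (hα (sA i) i).1 h1.symm
    grind
  have nt : ∀ i, i ≠ t → sA i ≠ t := fun i h1 h2 => by
    apply h1
    rw [← iA i, h2, hAt]
  have fix : ∀ i, i ≠ t → sA i ≠ i := fun i h1 h2 => by
    have := hty i h1
    have := hAB i
    have := hAC i
    grind
  have hcov : ∀ x y z x' y' z', (∀ i, cnt x y z (α i) (β i) (γ i) = cnt x' y' z' (α i) (β i) (γ i)) →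
      x ≠ x' → ∀ i, x = α i → y' = β i ∨ z' = γ i := by
    intro x y z x' y' z' H hne i hi
    have := H i
    unfold cnt at this
    grind
  have hpair : ∀ x y z x' y' z', (∀ i, cnt x y z (α i) (β i) (γ i) = cnt x' y' z' (α i) (β i) (γ i)) →
      x ≠ x' → ∀ i, i ≠ t → x = α i → ∃ p, p ≠ t ∧ x = α p ∧ y' = β p ∧ z' = γ (sA p) := by
    intro x y z x' y' z' H hne i hit hi
    have e0 : x = α (sA i) := hi.trans ((hα _ _).2 (Or.inr rfl))
    have h1 := hcov x y z x' y' z' H hne i hi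
    have h2 := hcov x y z x' y' z' H hne (sA i) e0
    have e1 := hβ i (sA i)
    have e2 := hγ i (sA i)
    have e3 := fix i hit
    have e4 := hAB i
    have e5 := hAC i
    by_cases hc : y' = β i
    · refine ⟨i, hit, hi, hc, ?_⟩
      grind
    · refine ⟨sA i, nt i hit, e0, ?_, ?_⟩
      · grind
      · rw [iA]
        grind
  by_cases hx : x = x'
  · subst hx
    refine ⟨rfl, abs_yz β γ sB sC hβ hγ hBC hβs hγs y y' z z' fun i => ?_⟩
    have := H i
    unfold cnt at this
    omega
  · exfalso
    have H' := fun i => (H i).symm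
    have hx' := Ne.symm hx
    obtain ⟨p, hp⟩ := hαs x
    obtain ⟨r, hr⟩ := hαs x'
    by_cases hpt : p = t
    · have hrt : r ≠ t := by rintro rfl; exact hx (by rw [hp, hr, hpt])
      obtain ⟨r, hr1, hr2, hr3, hr4⟩ := hpair _ _ _ _ _ _ H' hx' r hrt hr
      rw [hpt] at hp
      exact abs_tp α β γ sA sB sC t hα hβ hγ hAt hBt hCt (hBC t) hAB hAC hty hmix hmix' r hr1
        (nt r hr1) x x' y y' z z' hp hr2 (hcov _ _ _ _ _ _ H hx t hp) hr3 hr4 H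
    · obtain ⟨p, hp1, hp2, hp3, hp4⟩ := hpair _ _ _ _ _ _ H hx p hpt hp
      by_cases hrt : r = t
      · rw [hrt] at hr
        exact abs_tp α β γ sA sB sC t hα hβ hγ hAt hBt hCt (hBC t) hAB hAC hty hmix hmix' p hp1
          (nt p hp1) x' x y' y z' z hr hp2 (hcov _ _ _ _ _ _ H' hx' t hr) hp3 hp4 H'
      · obtain ⟨r, hr1, hr2, hr3, hr4⟩ := hpair _ _ _ _ _ _ H' hx' r hrt hr
        exact abs_pp α β γ sA sB sC t hα hβ hγ hAB hAC hty hmix hmix' p r hp1 (nt p hp1)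
          hr1 (nt r hr1) x x' y y' z z' hp2 hr2 hx hp3 hp4 hr3 hr4 H

end abs

lemma upper_gen (a k : ℕ) (hk : 1 ≤ k) (hM : k + 3 ≤ a) :
    ∃ Q : Finset (Question a (a + k) (2 * a - k)), Feasible Q ∧ Q.card ≤ 2 * a - 1 := by
  let α : Fin (2 * a - 1) → Fin a := fun i => ⟨(i.1 + 1) / 2, by omega⟩
  let β : Fin (2 * a - 1) → Fin (a + k) := fun i =>
    ⟨if i.1 < 2 * k then i.1 else if i.1 = 2 * k then 0 else
      if i.1 = 2 * k + 1 ∨ i.1 = 2 * a - 2 then 2 * k else i.1 / 2 + k, by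
        have := i.2; split_ifs <;> omega⟩
  let γ : Fin (2 * a - 1) → Fin (2 * a - k) := fun i =>
    ⟨if i.1 < 2 * k then i.1 / 2 else i.1 - k, by have := i.2; split_ifs <;> omega⟩
  let sA : Fin (2 * a - 1) → Fin (2 * a - 1) := fun i =>
    ⟨if i.1 = 0 then 0 else if i.1 % 2 = 1 then i.1 + 1 else i.1 - 1, by
      have := i.2; split_ifs <;> omega⟩
  let sB : Fin (2 * a - 1) → Fin (2 * a - 1) := fun i =>
    ⟨if i.1 = 0 then 2 * k else if i.1 < 2 * k then i.1 else if i.1 = 2 * k then 0 else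
      if i.1 = 2 * k + 1 then 2 * a - 2 else if i.1 = 2 * a - 2 then 2 * k + 1 else
      if i.1 % 2 = 0 then i.1 + 1 else i.1 - 1, by
      have := i.2; split_ifs <;> omega⟩
  let sC : Fin (2 * a - 1) → Fin (2 * a - 1) := fun i =>
    ⟨if i.1 < 2 * k then (if i.1 % 2 = 0 then i.1 + 1 else i.1 - 1) else i.1, by
      have := i.2; split_ifs <;> omega⟩
  let t : Fin (2 * a - 1) := ⟨0, by omega⟩
  have fC : ∀ i, sC i = i ↔ 2 * k ≤ i.1 := by
    rintro ⟨i, hi⟩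
    simp only [sC, Fin.mk.injEq]
    split_ifs <;> omega
  have fB : ∀ i, sB i = i ↔ 0 < i.1 ∧ i.1 < 2 * k := by
    rintro ⟨i, hi⟩
    simp only [sB, Fin.mk.injEq]
    split_ifs <;> omega
  have vA : ∀ i, (sA i).1 = if i.1 = 0 then 0 else if i.1 % 2 = 1 then i.1 + 1 else i.1 - 1 :=
    fun i => rfl
  have vBt : (sB t).1 = 2 * k := by simp [sB, t]
  apply upper_of α β γ
  apply abs_main α β γ sA sB sC t
  · rintro ⟨i, hi⟩ ⟨j, hj⟩
    simp only [α, sA, Fin.mk.injEq]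
    split_ifs <;> omega
  · rintro ⟨i, hi⟩ ⟨j, hj⟩
    simp only [β, sB, Fin.mk.injEq]
    split_ifs <;> omega
  · rintro ⟨i, hi⟩ ⟨j, hj⟩
    simp only [γ, sC, Fin.mk.injEq]
    split_ifs <;> omega
  · rintro ⟨x, hx⟩
    refine ⟨⟨2 * x, by omega⟩, ?_⟩
    simp only [α, Fin.mk.injEq]
    omega
  · have key : ∀ y : Fin (a + k), (∀ i, y ≠ β i) → y.1 = a + k - 1 := by
      rintro ⟨y, hy⟩ h
      by_contra hne
      simp only at hne
      by_cases h1 : y ≤ 2 * k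
      · by_cases h2 : y = 2 * k
        · refine h ⟨2 * k + 1, by omega⟩ ?_
          simp only [β, Fin.mk.injEq]
          split_ifs <;> omega
        · refine h ⟨y, by omega⟩ ?_
          simp only [β, Fin.mk.injEq]
          split_ifs <;> omega
      · refine h ⟨2 * (y - k), by omega⟩ ?_
        simp only [β, Fin.mk.injEq]
        split_ifs <;> omega
    intro y y' h h'
    exact Fin.ext ((key y h).trans (key y' h').symm)
  · have key : ∀ y : Fin (2 * a - k), (∀ i, y ≠ γ i) → y.1 = 2 * a - k - 1 := by
      rintro ⟨y, hy⟩ h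
      by_contra hne
      simp only at hne
      by_cases h1 : y < k
      · refine h ⟨2 * y, by omega⟩ ?_
        simp only [γ, Fin.mk.injEq]
        split_ifs <;> omega
      · refine h ⟨y + k, by omega⟩ ?_
        simp only [γ, Fin.mk.injEq]
        split_ifs <;> omega
    intro y y' h h'
    exact Fin.ext ((key y h).trans (key y' h').symm)
  · simp [sA, t]
  · intro h
    have h1 := congrArg Fin.val h
    rw [vBt] at h1
    simp only [t] at h1
    omega
  · rw [ne_eq, fC]
    simp only [t]
    omega
  · rintro ⟨i, hi⟩
    intro h
    have h1 := congrArg Fin.val h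
    simp only [sA, sB] at h1
    split_ifs at h1 <;> omega
  · rintro ⟨i, hi⟩
    intro h
    have h1 := congrArg Fin.val h
    simp only [sA, sC] at h1
    split_ifs at h1 <;> omega
  · rintro ⟨i, hi⟩
    intro h
    have h1 := congrArg Fin.val h
    simp only [sB, sC] at h1
    split_ifs at h1 <;> omega
  · intro i hit
    have h0 : i.1 ≠ 0 := fun h => hit (Fin.ext h)
    rw [ne_eq, fC, fB]
    omega
  · intro i hit h1 h2
    rw [fC] at h1
    rw [ne_eq, fC, vA] at h2
    apply Fin.ext
    rw [vBt]
    split_ifs at h2 <;> omega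
  · rw [ne_eq, fC, vA, vBt]
    split_ifs <;> omega

lemma abst_zero {I A B C : Type*} [DecidableEq A] [DecidableEq B] [DecidableEq C]
    (α : I → A) (β : I → B) (γ : I → C) (sA sB : I → I) (e d : I)
    (hα : ∀ i j, α i = α j ↔ j = i ∨ j = sA i)
    (hβ : ∀ i j, β i = β j ↔ j = i ∨ j = sB i)
    (hγ : ∀ i j, γ i = γ j ↔ j = i)
    (hαs : ∀ x, ∃ i, x = α i)
    (hβs : ∀ y, ∃ i, y = β i)
    (hγs : ∀ y y', (∀ i, y ≠ γ i) → (∀ i, y' ≠ γ i) → y = y')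
    (hA : ∀ i, sA i = i ↔ i = e) (hB : ∀ i, sB i = i ↔ i = d)
    (hAB : ∀ i, sA i ≠ sB i)
    (x : A) (y : B) (z : C) (x' : A) (y' : B) (z' : C)
    (H : ∀ i, cnt x y z (α i) (β i) (γ i) = cnt x' y' z' (α i) (β i) (γ i)) :
    x = x' ∧ y = y' ∧ z = z' := by
  have iA : ∀ i, sA (sA i) = i := fun i => by
    have h1 := (hα i (sA i)).2 (Or.inr rfl)
    have h2 := (hα (sA i) i).1 h1.symm
    grind
  have iB : ∀ i, sB (sB i) = i := fun i => by
    have h1 := (hβ i (sB i)).2 (Or.inr rfl)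
    have h2 := (hβ (sB i) i).1 h1.symm
    grind
  obtain ⟨p, rfl⟩ := hαs x
  obtain ⟨r, rfl⟩ := hαs x'
  obtain ⟨u, rfl⟩ := hβs y
  obtain ⟨v, rfl⟩ := hβs y'
  have hz : ∀ z z', (∀ i, (if z = γ i then 1 else 0) = (if z' = γ i then 1 else 0)) → z = z' := by
    intro z z' H
    by_contra hne
    by_cases h1 : ∃ i, z = γ i
    · obtain ⟨i, hi⟩ := h1
      have := H i
      grind
    · by_cases h2 : ∃ i, z' = γ i
      · obtain ⟨i, hi⟩ := h2
        have := H i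
        grind
      · push Not at h1 h2
        exact hne (hγs z z' h1 h2)
  have zu : ∀ i j, z = γ i → z = γ j → j = i := fun i j h1 h2 => (hγ i j).1 (h1.symm.trans h2)
  have zu' : ∀ i j, z' = γ i → z' = γ j → j = i := fun i j h1 h2 => (hγ i j).1 (h1.symm.trans h2)
  by_cases hx : α p = α r
  · refine ⟨hx, ?_⟩
    by_cases hy : β u = β v
    · refine ⟨hy, hz z z' fun i => ?_⟩
      have := H i
      simp only [cnt, hx, hy] at this
      omega
    · exfalso
      have H1 := H u
      have H2 := H (sB u)
      have H3 := H v
      have H4 := H (sB v)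
      have := hB u
      have := hB v
      simp only [cnt, hx] at H1 H2 H3 H4
      rw [hβ] at hy
      grind
  · exfalso
    have hcov : ∀ x y z x' y' z',
        (∀ i, cnt x y z (α i) (β i) (γ i) = cnt x' y' z' (α i) (β i) (γ i)) →
        x ≠ x' → ∀ i, x = α i → y' = β i ∨ z' = γ i := by
      intro x y z x' y' z' H hne i hi
      have := H i
      unfold cnt at this
      grind
    have hpair : ∀ x y z x' y' z',
        (∀ i, cnt x y z (α i) (β i) (γ i) = cnt x' y' z' (α i) (β i) (γ i)) →
        x ≠ x' → ∀ i, i ≠ e → x = α i → ∃ p, p ≠ e ∧ x = α p ∧ y' = β p ∧ z' = γ (sA p) := by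
      intro x y z x' y' z' H hne i hit hi
      have e0 : x = α (sA i) := hi.trans ((hα _ _).2 (Or.inr rfl))
      have h1 := hcov x y z x' y' z' H hne i hi
      have h2 := hcov x y z x' y' z' H hne (sA i) e0
      have e1 := hβ i (sA i)
      have e2 := hγ i (sA i)
      have e3 := hA i
      have e4 := hAB i
      by_cases hc : y' = β i
      · refine ⟨i, hit, hi, hc, ?_⟩
        grind
      · refine ⟨sA i, ?_, e0, ?_, ?_⟩
        · grind
        · grind
        · rw [iA]
          grind
    have single : ∀ r v z', r ≠ e → α e ≠ α r → (∀ i j, z' = γ i → z' = γ j → j = i) →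
        (β v = β e ∨ z' = γ e) →
        (∀ i, cnt (α e) (β r) (γ (sA r)) (α i) (β i) (γ i) = cnt (α r) (β v) z' (α i) (β i) (γ i))
        → False := by
      clear H zu zu'
      intro r v z' hre hne zu' hor H
      have H0 := H e
      have H3 := H r
      have H4 := H (sA r)
      have H5 := H (sB r)
      have H6 := H v
      have H7 := H (sB v)
      have H8 := H (sB e)
      have := hA r
      have := hB r
      have := hB e
      have := hA e
      have := hAB e
      have := hAB r
      rcases hor with hor | hor
      · simp only [cnt, hor, hα, hβ, hγ] at H0 H3 H4 H5 H8
        grind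
      · subst hor
        simp only [cnt, hα, hβ, hγ] at H0 H3 H4 H5 H6 H7
        have := hB v
        grind
    have H' := fun i => (H i).symm
    have hx' := Ne.symm hx
    by_cases hpt : p = e
    · have hrt : r ≠ e := by rintro rfl; exact hx (by rw [hpt])
      obtain ⟨r, hr1, hr2, hr3, hr4⟩ := hpair _ _ _ _ _ _ H' hx' r hrt rfl
      subst hpt
      have hcv := hcov _ _ _ _ _ _ H hx p rfl
      rw [hr2, hr3, hr4] at H
      exact single r v z' hr1 (hr2 ▸ hx) zu' hcv H
    · obtain ⟨p, hp1, hp2, hp3, hp4⟩ := hpair _ _ _ _ _ _ H hx p hpt rfl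
      by_cases hrt : r = e
      · subst hrt
        have hcv := hcov _ _ _ _ _ _ H' hx' r rfl
        rw [hp2, hp3, hp4] at H'
        exact single p u z hp1 (hp2 ▸ hx') zu hcv H'
      · obtain ⟨r, hr1, hr2, hr3, hr4⟩ := hpair _ _ _ _ _ _ H' hx' r hrt rfl
        rw [hp2, hr2] at hx
        rw [hp2, hp3, hp4, hr2, hr3, hr4] at H
        rw [hα] at hx
        have H1 := H p
        have H2 := H (sA p)
        have H3 := H r
        have H4 := H (sA r)
        have H5 := H (sB p)
        have H6 := H (sB r)
        have := hA p
        have := hA r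
        have := hB p
        have := hB r
        have := hAB p
        have := hAB r
        simp only [cnt, hα, hβ, hγ] at H1 H2 H3 H4 H5 H6
        grind

lemma upper_zero (a : ℕ) (ha : 2 ≤ a) :
    ∃ Q : Finset (Question a a (2 * a)), Feasible Q ∧ Q.card ≤ 2 * a - 1 := by
  let α : Fin (2 * a - 1) → Fin a := fun i => ⟨i.1 / 2, by omega⟩
  let β : Fin (2 * a - 1) → Fin a := fun i => ⟨(i.1 + 1) / 2, by omega⟩
  let γ : Fin (2 * a - 1) → Fin (2 * a) := fun i => ⟨i.1, by omega⟩
  let sA : Fin (2 * a - 1) → Fin (2 * a - 1) := fun i =>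
    ⟨if i.1 = 2 * a - 2 then i.1 else if i.1 % 2 = 0 then i.1 + 1 else i.1 - 1, by
      have := i.2; split_ifs <;> omega⟩
  let sB : Fin (2 * a - 1) → Fin (2 * a - 1) := fun i =>
    ⟨if i.1 = 0 then i.1 else if i.1 % 2 = 1 then i.1 + 1 else i.1 - 1, by
      have := i.2; split_ifs <;> omega⟩
  apply upper_of α β γ
  apply abst_zero α β γ sA sB ⟨2 * a - 2, by omega⟩ ⟨0, by omega⟩
  · rintro ⟨i, hi⟩ ⟨j, hj⟩
    simp only [α, sA, Fin.mk.injEq]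
    split_ifs <;> omega
  · rintro ⟨i, hi⟩ ⟨j, hj⟩
    simp only [β, sB, Fin.mk.injEq]
    split_ifs <;> omega
  · rintro ⟨i, hi⟩ ⟨j, hj⟩
    simp only [γ, Fin.mk.injEq]
    omega
  · rintro ⟨x, hx⟩
    refine ⟨⟨2 * x, by omega⟩, ?_⟩
    simp only [α, Fin.mk.injEq]
    omega
  · rintro ⟨x, hx⟩
    refine ⟨⟨2 * x, by omega⟩, ?_⟩
    simp only [β, Fin.mk.injEq]
    omega
  · have key : ∀ y : Fin (2 * a), (∀ i, y ≠ γ i) → y.1 = 2 * a - 1 := by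
      rintro ⟨y, hy⟩ h
      by_contra hne
      exact h ⟨y, by simp only at hne; omega⟩ rfl
    intro y y' h h'
    exact Fin.ext ((key y h).trans (key y' h').symm)
  · rintro ⟨i, hi⟩
    simp only [sA, Fin.mk.injEq]
    split_ifs <;> omega
  · rintro ⟨i, hi⟩
    simp only [sB, Fin.mk.injEq]
    split_ifs <;> omega
  · rintro ⟨i, hi⟩
    simp only [sA, sB, ne_eq, Fin.mk.injEq]
    split_ifs <;> omega

lemma upper_112 : ∃ Q : Finset (Question 1 1 2), Feasible Q ∧ Q.card ≤ 1 := by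
  apply upper_of ![0] ![0] ![0]
  decide

lemma upper_233 : ∃ Q : Finset (Question 2 3 3), Feasible Q ∧ Q.card ≤ 3 := by
  apply upper_of (N := 3) ![0, 1, 1] ![0, 0, 1] ![0, 1, 0]
  apply abs_main (I := Fin 3) ![0, 1, 1] ![0, 0, 1] ![0, 1, 0] ![0, 2, 1] ![1, 0, 2] ![2, 1, 0] 0 <;>
    decide

/-- here the roles of the second and third coordinate are exchanged in `abs_main` -/
lemma upper_345 : ∃ Q : Finset (Question 3 4 5), Feasible Q ∧ Q.card ≤ 5 := by
  apply upper_of (N := 5) ![0, 1, 1, 2, 2] ![0, 0, 1, 1, 2] ![0, 1, 2, 3, 0]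
  intro x y z x' y' z' H
  have key := abs_main (I := Fin 5) (A := Fin 3) (B := Fin 5) (C := Fin 4)
    ![0, 1, 1, 2, 2] ![0, 1, 2, 3, 0] ![0, 0, 1, 1, 2]
    ![0, 2, 1, 4, 3] ![4, 1, 2, 3, 0] ![1, 0, 3, 2, 4] 0 (by decide) (by decide) (by decide)
    (by decide) (by decide) (by decide) (by decide) (by decide) (by decide) (by decide) (by decide)
    (by decide) (by decide) (by decide) (by decide) x z y x' z' y' (fun i => by
      have := H i
      unfold cnt at this ⊢
      omega)
  exact ⟨key.1, key.2.2, key.2.1⟩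

theorem f_3a_eq_b_add_c (a b c : ℕ) (ha : 0 < a) (hab : a ≤ b) (hbc : b ≤ c)
    (h3a : 3 * a = b + c) (hne : ¬(a = 4 ∧ b = 6 ∧ c = 6)) :
    f a b c = (a + b + c) / 2 - 1 := by
  have up : ∃ Q : Finset (Question a b c), Feasible Q ∧ Q.card ≤ 2 * a - 1 := by
    obtain ⟨k, rfl⟩ : ∃ k, b = a + k := ⟨b - a, by omega⟩
    obtain rfl : c = 2 * a - k := by omega
    by_cases hk : k = 0
    · subst hk
      by_cases h1 : a = 1
      · subst h1; exact upper_112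
      · exact upper_zero a (by omega)
    · by_cases hM : k + 3 ≤ a
      · exact upper_gen a k (by omega) hM
      · by_cases h2 : a = 2
        · obtain rfl : k = 1 := by omega
          subst h2; exact upper_233
        · obtain rfl : k = 1 := by omega
          obtain rfl : a = 3 := by omega
          exact upper_345
  obtain ⟨Q, hQ, hcard⟩ := up
  have e : (a + b + c) / 2 - 1 = 2 * a - 1 := by omega
  rw [e]
  unfold f
  apply le_antisymm
  · refine le_trans (Nat.sInf_le ?_) hcard
    exact ⟨Q, hQ, rfl⟩
  · refine le_csInf ?_ ?_
    · exact ⟨Q.card, Q, hQ, rfl⟩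
    rintro n ⟨Q', hQ', rfl⟩
    exact lower ha (by omega) (by omega) h3a Q' hQ'
end

section
/- It holds that f(4,6,6) = 8; in particular there is no feasible strategy for (4,6,6)-Mastermind with 7 questions. -/
namespace MM

/-- All lists obtained from `L` by adding `w` to one of its entries. -/
def ins (w : ℕ) : List ℕ → List (List ℕ)
  | [] => []
  | a :: L => ((a + w) :: L) :: (ins w L).map (fun M => a :: M)

/-- Enumerate all set partitions (up to relabelling) of the weights into at most `n` classes. -/
def search (n : ℕ) (K : List ℕ → Bool) : List ℕ → List ℕ → Bool
  | [], L => K (L ++ List.replicate (n - L.length) 0)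
  | w :: ws, L =>
    (ins w L).all (fun M => search n K ws M) &&
      (Nat.ble n L.length || search n K ws (L ++ [w]))

/-- Form the sumset of the bit set `S` and `L`, returning `true` on a collision. -/
def comb (S : ℕ) (K : ℕ → Bool) : ℕ → List ℕ → Bool
  | acc, [] => K acc
  | acc, a :: L =>
    match Nat.beq (Nat.land (Nat.shiftLeft S a) acc) 0 with
    | true => comb S K (Nat.lor acc (Nat.shiftLeft S a)) L
    | false => true

def ws : List ℕ := [1, 4, 16, 64, 256, 1024, 4096]

def chk (LB : List ℕ) : Bool :=
  comb 1 (fun S => search 6 (fun LC =>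
    comb S (fun S2 => search 4 (fun LA => comb S2 (fun _ => false) 0 LA) ws []) 0 LC) ws []) 0 LB

set_option maxRecDepth 100000 in
theorem chk00 : chk [1 + 1024 + 4096, 4, 16, 64, 256, 0] = true := by decide +kernel
set_option maxRecDepth 100000 in
theorem chk01 : chk [1 + 1024, 4 + 4096, 16, 64, 256, 0] = true := by decide +kernel
set_option maxRecDepth 100000 in
theorem chk05 : chk [1 + 1024, 4, 16, 64, 256, 4096] = true := by decide +kernel
set_option maxRecDepth 100000 in
theorem chk55 : chk [1, 4, 16, 64, 256, 1024 + 4096] = true := by decide +kernel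

def wt {n : ℕ} (ps : List (ℕ × Fin n)) (k : Fin n) : ℕ :=
  (ps.map (fun p => if p.2 = k then p.1 else 0)).sum

theorem ins_mem {n : ℕ} (w : ℕ) (m : Fin n → ℕ) (k : Fin n) :
    ∀ l : List (Fin n), l.Nodup → k ∈ l →
      l.map (Function.update m k (m k + w)) ∈ ins w (l.map m) := by
  intro l
  induction l with
  | nil => intro _ h; simp at h
  | cons a l ih =>
    intro hnd hk
    rw [List.nodup_cons] at hnd
    simp only [List.map_cons, ins, List.mem_cons, List.mem_map]
    by_cases hak : a = k
    · left
      subst hak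
      simp only [Function.update_self, List.cons.injEq, true_and]
      apply List.map_congr_left
      intro x hx
      rw [Function.update_of_ne]
      rintro rfl
      exact hnd.1 hx
    · right
      refine ⟨_, ih hnd.2 ?_, ?_⟩
      · rcases List.mem_cons.1 hk with h | h
        · exact absurd h.symm hak
        · exact h
      · rw [Function.update_of_ne hak]

theorem search_sound {n : ℕ} (K : List ℕ → Bool) :
    ∀ (ps : List (ℕ × Fin n)) (l : List (Fin n)) (m : Fin n → ℕ), l.Nodup →
      (∀ k, k ∉ l → m k = 0) → search n K (ps.map Prod.fst) (l.map m) = true →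
      ∃ l' : List (Fin n), l'.Nodup ∧ K (l'.map (fun k => m k + wt ps k)) = true := by
  intro ps
  induction ps with
  | nil =>
    intro l m hnd hm h
    have hnd' : (l ++ (List.finRange n).filter (fun k => k ∉ l)).Nodup := by
      rw [List.nodup_append]
      refine ⟨hnd, (List.nodup_finRange n).filter _, ?_⟩
      intro a ha b hb
      simp at hb
      rintro rfl
      exact hb ha
    refine ⟨l ++ (List.finRange n).filter (fun k => k ∉ l), hnd', ?_⟩
    have hlen : (l ++ (List.finRange n).filter (fun k => k ∉ l)).length = n := by
      have hu : (l ++ (List.finRange n).filter (fun k => k ∉ l)).toFinset = Finset.univ := by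
        ext x
        simp
        tauto
      rw [← List.toFinset_card_of_nodup hnd', hu]
      simp
    rw [List.length_append] at hlen
    simp only [List.map_nil, search, List.length_map] at h
    convert h using 1
    congr 1
    rw [List.map_append]
    congr 1
    rw [List.eq_replicate_iff]
    constructor
    · rw [List.length_map]; omega
    · intro b hb
      rw [List.mem_map] at hb
      obtain ⟨a, ha, rfl⟩ := hb
      simp at ha
      simp [wt, hm a ha]
  | cons p ps ih =>
    intro l m hnd hm h
    obtain ⟨w, k⟩ := p
    simp only [List.map_cons, search, Bool.and_eq_true, List.all_eq_true, Bool.or_eq_true] at h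
    obtain ⟨h1, h2⟩ := h
    have key : (fun j => Function.update m k (m k + w) j + wt ps j) =
        (fun j => m j + wt ((w, k) :: ps) j) := by
      funext j
      by_cases hj : j = k
      · subst hj; simp [wt, add_assoc]
      · rw [Function.update_of_ne hj]; simp [wt, Ne.symm hj]
    rw [← key]
    by_cases hk : k ∈ l
    · refine ih l _ hnd ?_ (h1 _ (ins_mem w m k l hnd hk))
      intro j hj
      rw [Function.update_of_ne, hm j hj]
      rintro rfl
      exact hj hk
    · refine ih (l ++ [k]) _ ?_ ?_ ?_
      · rw [List.nodup_append]
        refine ⟨hnd, by simp, ?_⟩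
        intro a ha b hb
        simp at hb
        rintro rfl
        exact hk (hb ▸ ha)
      · intro j hj
        simp at hj
        rw [Function.update_of_ne hj.2, hm j hj.1]
      · rcases h2 with h2 | h2
        · exfalso
          have h3 : n ≤ l.length := by simpa using Nat.le_of_ble_eq_true h2
          have h4 : (k :: l).Nodup := List.nodup_cons.2 ⟨hk, hnd⟩
          have h5 := h4.length_le_card
          simp at h5
          omega
        · convert h2 using 2
          rw [List.map_append]
          congr 1
          · apply List.map_congr_left
            intro x hx
            rw [Function.update_of_ne]
            rintro rfl
            exact hk hx
          · simp [hm k hk]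

theorem comb_sound {n : ℕ} {X : Type} (S : ℕ) (K : ℕ → Bool) (σ : X → ℕ) (γ : Fin n → ℕ)
    (hS : ∀ b, S.testBit b = true → ∃ x, σ x = b)
    (hinj : ∀ x k x' k', σ x + γ k = σ x' + γ k' → k = k') :
    ∀ (l : List (Fin n)) (acc : ℕ), l.Nodup →
      (∀ b, acc.testBit b = true → ∃ x k, k ∉ l ∧ σ x + γ k = b) →
      comb S K acc (l.map γ) = true →
      ∃ S', K S' = true ∧ ∀ b, S'.testBit b = true → ∃ y : X × Fin n, σ y.1 + γ y.2 = b := by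
  have hsh : ∀ a b, (Nat.shiftLeft S a).testBit b = true → ∃ x, σ x + a = b := by
    intro a b h
    change (S <<< a).testBit b = true at h
    rw [Nat.testBit_shiftLeft] at h
    simp at h
    obtain ⟨x, hx⟩ := hS _ h.2
    exact ⟨x, by omega⟩
  intro l
  induction l with
  | nil =>
    intro acc _ hacc h
    refine ⟨acc, h, ?_⟩
    intro b hb
    obtain ⟨x, k, -, hx⟩ := hacc b hb
    exact ⟨(x, k), hx⟩
  | cons k l ih =>
    intro acc hnd hacc h
    rw [List.nodup_cons] at hnd
    have h0 : Nat.land (Nat.shiftLeft S (γ k)) acc = 0 := by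
      apply Nat.eq_of_testBit_eq
      intro b
      rw [Nat.zero_testBit]
      change ((Nat.shiftLeft S (γ k)) &&& acc).testBit b = false
      rw [Nat.testBit_and]
      by_contra hc
      simp only [Bool.not_eq_false, Bool.and_eq_true] at hc
      obtain ⟨x, hx⟩ := hsh _ _ hc.1
      obtain ⟨x', k', hk', hx'⟩ := hacc _ hc.2
      have := hinj x k x' k' (hx.trans hx'.symm)
      subst this
      simp at hk'
    simp only [List.map_cons, comb, h0] at h
    refine ih _ hnd.2 ?_ h
    intro b hb
    change (acc ||| (Nat.shiftLeft S (γ k))).testBit b = true at hb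
    rw [Nat.testBit_or, Bool.or_eq_true] at hb
    rcases hb with hb | hb
    · obtain ⟨x, k', hk', hx⟩ := hacc b hb
      simp at hk'
      exact ⟨x, k', hk'.2, hx⟩
    · obtain ⟨x, hx⟩ := hsh _ _ hb
      exact ⟨x, k, hnd.1, hx⟩

/-- Mask of a class. -/
def mask {n : ℕ} (h : Fin 7 → Fin n) (k : Fin n) : ℕ :=
  wt [(1, h 0), (4, h 1), (16, h 2), (64, h 3), (256, h 4), (1024, h 5), (4096, h 6)] k

theorem chk_sound (A : Fin 7 → Fin 4) (B C : Fin 7 → Fin 6)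
    (hinj : ∀ i j k i' j' k', mask A i + mask B j + mask C k =
      mask A i' + mask B j' + mask C k' → i = i' ∧ j = j' ∧ k = k')
    (h : chk ((List.finRange 6).map (mask B)) = true) : False := by
  obtain ⟨S, hS, hSb⟩ := comb_sound (X := Unit) 1 _ (fun _ => 0) (mask B)
    (by
      intro b hb
      refine ⟨(), ?_⟩
      rw [Nat.testBit_one_eq_true_iff_self_eq_zero] at hb
      exact hb.symm)
    (by
      intro _ k _ k' hk
      exact (hinj 0 k 0 0 k' 0 (by omega)).2.1)
    _ 0 (List.nodup_finRange 6) (by simp) h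
  obtain ⟨l, hl, h2⟩ := search_sound _ [(1, C 0), (4, C 1), (16, C 2), (64, C 3), (256, C 4),
    (1024, C 5), (4096, C 6)] [] (fun _ => 0) (by simp) (by simp) hS
  simp only [Nat.zero_add] at h2
  obtain ⟨S2, hS2, hSb2⟩ := comb_sound _ _ (fun y : Unit × Fin 6 => 0 + mask B y.2) (mask C) hSb
    (by
      rintro ⟨_, j⟩ k ⟨_, j'⟩ k' hk
      exact (hinj 0 j k 0 j' k' (by simp only at hk; omega)).2.2)
    l 0 hl (by simp) h2
  obtain ⟨l', hl', h3⟩ := search_sound _ [(1, A 0), (4, A 1), (16, A 2), (64, A 3), (256, A 4),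
    (1024, A 5), (4096, A 6)] [] (fun _ => 0) (by simp) (by simp) hS2
  simp only [Nat.zero_add] at h3
  obtain ⟨S3, hS3, -⟩ := comb_sound _ _
    (fun y : (Unit × Fin 6) × Fin 6 => 0 + mask B y.1.2 + mask C y.2) (mask A) hSb2
    (by
      rintro ⟨⟨_, j⟩, k⟩ i ⟨⟨_, j'⟩, k'⟩ i' hk
      exact (hinj i j k i' j' k' (by simp only at hk; omega)).1)
    l' 0 hl' (by simp) h3
  simp at hS3

/-- Feasibility of an indexed family of questions. -/
def FF (A : Fin 7 → Fin 4) (B C : Fin 7 → Fin 6) : Prop :=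
  ∀ s s' : Question 4 6 6, (∀ t, g s (A t, B t, C t) = g s' (A t, B t, C t)) → s = s'

theorem g_le (s q : Question 4 6 6) : g s q ≤ 3 := by
  unfold g; split_ifs <;> omega

theorem mask_sum (A : Fin 7 → Fin 4) (B C : Fin 7 → Fin 6) (i : Fin 4) (j k : Fin 6) :
    mask A i + mask B j + mask C k =
      g (i, j, k) (A 0, B 0, C 0) + 4 * g (i, j, k) (A 1, B 1, C 1)
      + 16 * g (i, j, k) (A 2, B 2, C 2) + 64 * g (i, j, k) (A 3, B 3, C 3)
      + 256 * g (i, j, k) (A 4, B 4, C 4) + 1024 * g (i, j, k) (A 5, B 5, C 5)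
      + 4096 * g (i, j, k) (A 6, B 6, C 6) := by
  obtain ⟨d, hd⟩ : ∃ d : (n : ℕ) → Fin n → Fin n → ℕ,
      ∀ n x y, d n x y = if x = y then 1 else 0 := ⟨_, fun _ _ _ => rfl⟩
  have e : ∀ (n : ℕ) (x y : Fin n) (w : ℕ), (if x = y then w else 0) = w * d n x y := by
    intro n x y w
    rw [hd]; split_ifs <;> simp
  have hg : ∀ a b c, g (i, j, k) ((a, b, c) : Question 4 6 6) =
      d 4 a i + d 6 b j + d 6 c k := by
    intro a b c
    simp only [g, hd, eq_comm]
  simp only [hg, mask, wt, List.map_cons, List.map_nil, List.sum_cons, List.sum_nil, e]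
  ring

theorem FF.inj {A : Fin 7 → Fin 4} {B C : Fin 7 → Fin 6} (h : FF A B C) :
    ∀ i j k i' j' k', mask A i + mask B j + mask C k =
      mask A i' + mask B j' + mask C k' → i = i' ∧ j = j' ∧ k = k' := by
  intro i j k i' j' k' he
  have := h (i, j, k) (i', j', k') ?_
  · simpa using this
  · rw [mask_sum, mask_sum] at he
    have b1 := fun t => g_le (i, j, k) (A t, B t, C t)
    have b2 := fun t => g_le (i', j', k') (A t, B t, C t)
    have b10 := b1 0; have b11 := b1 1; have b12 := b1 2; have b13 := b1 3
    have b14 := b1 4; have b15 := b1 5; have b16 := b1 6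
    have b20 := b2 0; have b21 := b2 1; have b22 := b2 2; have b23 := b2 3
    have b24 := b2 4; have b25 := b2 5; have b26 := b2 6
    intro t
    fin_cases t
    · change g (i, j, k) (A 0, B 0, C 0) = g (i', j', k') (A 0, B 0, C 0)
      omega
    · change g (i, j, k) (A 1, B 1, C 1) = g (i', j', k') (A 1, B 1, C 1)
      omega
    · change g (i, j, k) (A 2, B 2, C 2) = g (i', j', k') (A 2, B 2, C 2)
      omega
    · change g (i, j, k) (A 3, B 3, C 3) = g (i', j', k') (A 3, B 3, C 3)
      omega
    · change g (i, j, k) (A 4, B 4, C 4) = g (i', j', k') (A 4, B 4, C 4)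
      omega
    · change g (i, j, k) (A 5, B 5, C 5) = g (i', j', k') (A 5, B 5, C 5)
      omega
    · change g (i, j, k) (A 6, B 6, C 6) = g (i', j', k') (A 6, B 6, C 6)
      omega

theorem FF.perm {A : Fin 7 → Fin 4} {B C : Fin 7 → Fin 6} (h : FF A B C)
    (σ : Equiv.Perm (Fin 7)) : FF (A ∘ σ) (B ∘ σ) (C ∘ σ) := by
  intro s s' hs
  apply h
  intro t
  simpa using hs (σ.symm t)

theorem FF.relabel {A : Fin 7 → Fin 4} {B C : Fin 7 → Fin 6} (h : FF A B C)
    (τ : Equiv.Perm (Fin 6)) : FF A (τ ∘ B) C := by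
  rintro ⟨i, j, k⟩ ⟨i', j', k'⟩ hs
  have := h (i, τ.symm j, k) (i', τ.symm j', k') ?_
  · simpa using this
  · intro t
    have := hs t
    simpa [g, Equiv.symm_apply_eq] using this

/-- `B` cannot be completed to a feasible strategy. -/
def Bad (B : Fin 7 → Fin 6) : Prop := ∀ A C, ¬ FF A B C

theorem Bad.of {B : Fin 7 → Fin 6} (σ : Equiv.Perm (Fin 7)) (τ : Equiv.Perm (Fin 6))
    (h : Bad (τ ∘ B ∘ σ)) : Bad B := by
  intro A C hF
  exact h _ _ ((hF.perm σ).relabel τ)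

theorem bad_of_chk (B : Fin 7 → Fin 6) (h : chk ((List.finRange 6).map (mask B)) = true) :
    Bad B := fun A C hF => chk_sound A B C hF.inj h

theorem bad00 : Bad ![0, 1, 2, 3, 4, 0, 0] := bad_of_chk _ (by
  have : (List.finRange 6).map (mask ![0, 1, 2, 3, 4, 0, 0]) =
    [1 + 1024 + 4096, 4, 16, 64, 256, 0] := by decide +kernel
  rw [this]; exact chk00)
theorem bad01 : Bad ![0, 1, 2, 3, 4, 0, 1] := bad_of_chk _ (by
  have : (List.finRange 6).map (mask ![0, 1, 2, 3, 4, 0, 1]) =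
    [1 + 1024, 4 + 4096, 16, 64, 256, 0] := by decide +kernel
  rw [this]; exact chk01)
theorem bad05 : Bad ![0, 1, 2, 3, 4, 0, 5] := bad_of_chk _ (by
  have : (List.finRange 6).map (mask ![0, 1, 2, 3, 4, 0, 5]) =
    [1 + 1024, 4, 16, 64, 256, 4096] := by decide +kernel
  rw [this]; exact chk05)
theorem bad55 : Bad ![0, 1, 2, 3, 4, 5, 5] := bad_of_chk _ (by
  have : (List.finRange 6).map (mask ![0, 1, 2, 3, 4, 5, 5]) =
    [1, 4, 16, 64, 256, 1024 + 4096] := by decide +kernel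
  rw [this]; exact chk55)

theorem bad0 (v : Fin 6) : Bad ![0, 1, 2, 3, 4, 0, v] := by
  by_cases h0 : v = 0
  · subst h0; exact bad00
  by_cases h5 : v = 5
  · subst h5; exact bad05
  apply Bad.of (Equiv.swap 1 (v.castSucc)) (Equiv.swap 1 v)
  have : (Equiv.swap 1 v) ∘ ![0, 1, 2, 3, 4, 0, v] ∘ (Equiv.swap 1 (v.castSucc)) =
      ![0, 1, 2, 3, 4, 0, 1] := by
    revert v; decide +kernel
  rw [this]; exact bad01

theorem bad_ne (u v : Fin 6) (hu : u ≠ 5) : Bad ![0, 1, 2, 3, 4, u, v] := by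
  apply Bad.of (Equiv.swap 0 (u.castSucc)) (Equiv.swap 0 u)
  have : (Equiv.swap 0 u) ∘ ![0, 1, 2, 3, 4, u, v] ∘ (Equiv.swap 0 (u.castSucc)) =
      ![0, 1, 2, 3, 4, 0, Equiv.swap 0 u v] := by
    revert u v; decide +kernel
  rw [this]; exact bad0 _

theorem bad_all (u v : Fin 6) : Bad ![0, 1, 2, 3, 4, u, v] := by
  by_cases hu : u = 5
  · subst hu
    by_cases hv : v = 5
    · subst hv; exact bad55
    · apply Bad.of (Equiv.swap 5 6) 1
      have : (1 : Equiv.Perm (Fin 6)) ∘ ![0, 1, 2, 3, 4, 5, v] ∘ (Equiv.swap 5 6) =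
          ![0, 1, 2, 3, 4, v, 5] := by
        revert v; decide +kernel
      rw [this]; exact bad_ne _ _ hv
  · exact bad_ne _ _ hu

theorem exists_perm_extend {m n : ℕ} (hmn : m ≤ n) (e : Fin m → Fin n)
    (he : Function.Injective e) :
    ∃ σ : Equiv.Perm (Fin n), ∀ i, σ (Fin.castLE hmn i) = e i := by
  classical
  let e1 : Fin m ≃ Set.range (Fin.castLE hmn) :=
    Equiv.ofInjective _ (Fin.castLE_injective hmn)
  let e2 : Fin m ≃ Set.range e := Equiv.ofInjective _ he
  refine ⟨(e1.symm.trans e2).extendSubtype, ?_⟩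
  intro i
  rw [Equiv.extendSubtype_apply_of_mem _ _ ⟨i, rfl⟩]
  have : (⟨Fin.castLE hmn i, ⟨i, rfl⟩⟩ : Set.range (Fin.castLE hmn)) = e1 i := rfl
  rw [Equiv.trans_apply, this, Equiv.symm_apply_apply]
  rfl

theorem not_FF (A : Fin 7 → Fin 4) (B C : Fin 7 → Fin 6) : ¬ FF A B C := by
  intro hF
  -- at least five values are used
  have hcard : 5 ≤ (Finset.univ.image B).card := by
    by_contra hc
    have h1 : 1 < ((Finset.univ.image B)ᶜ).card := by
      rw [Finset.card_compl]; simp only [Fintype.card_fin]; omega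
    obtain ⟨j, hj, j', hj', hne⟩ := Finset.one_lt_card.1 h1
    simp only [Finset.mem_compl, Finset.mem_image, Finset.mem_univ, true_and, not_exists] at hj hj'
    have := hF (0, j, 0) (0, j', 0) (by
      intro t
      simp [g, Ne.symm (hj t), Ne.symm (hj' t)])
    simp at this
    exact hne this
  obtain ⟨T, hTs, hT⟩ := Finset.exists_subset_card_eq hcard
  let v : Fin 5 → Fin 6 := fun i => T.orderEmbOfFin hT i
  have hv : Function.Injective v := (T.orderEmbOfFin hT).injective
  have hpre : ∀ i, ∃ t, B t = v i := by
    intro i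
    have := hTs (T.orderEmbOfFin_mem hT i)
    simpa using this
  choose e he using hpre
  have hei : Function.Injective e := by
    intro i i' h
    apply hv
    rw [← he, ← he, h]
  obtain ⟨σ, hσ⟩ := exists_perm_extend (by norm_num) e hei
  obtain ⟨τ, hτ⟩ := exists_perm_extend (by norm_num) v hv
  have hb : ∀ i : Fin 5, (τ.symm ∘ B ∘ σ) (Fin.castLE (by norm_num) i) =
      Fin.castLE (by norm_num) i := by
    intro i
    simp only [Function.comp_apply]
    rw [hσ, he, ← hτ, Equiv.symm_apply_apply]
  have hfin : Bad (τ.symm ∘ B ∘ σ) := by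
    have : τ.symm ∘ B ∘ σ =
        ![0, 1, 2, 3, 4, (τ.symm ∘ B ∘ σ) 5, (τ.symm ∘ B ∘ σ) 6] := by
      generalize τ.symm ∘ B ∘ σ = D at hb
      funext t
      fin_cases t
      · exact hb 0
      · exact hb 1
      · exact hb 2
      · exact hb 3
      · exact hb 4
      · rfl
      · rfl
    rw [this]
    exact bad_all _ _
  exact Bad.of σ τ.symm hfin A C hF

theorem no7 (Q : Finset (Question 4 6 6)) (hQ : Feasible Q) : Q.card ≠ 7 := by
  intro hc
  let e := (Q.equivFinOfCardEq hc).symm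
  apply not_FF (fun t => (e t).1.1) (fun t => (e t).1.2.1) (fun t => (e t).1.2.2)
  intro s s' hs
  by_contra hne
  obtain ⟨q, hq, hg⟩ := hQ s s' hne
  apply hg
  have := hs (e.symm ⟨q, hq⟩)
  simpa using this

theorem no_le (Q : Finset (Question 4 6 6)) (hQ : Feasible Q) : 8 ≤ Q.card := by
  by_contra hlt
  obtain ⟨R, hQR, hR⟩ := Finset.exists_superset_card_eq (s := Q) (n := 7) (by omega) (by
    simp [Fintype.card_prod])
  refine no7 R ?_ hR
  intro s s' hne
  obtain ⟨q, hq, hg⟩ := hQ s s' hne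
  exact ⟨q, hQR hq, hg⟩

def Q8 : Finset (Question 4 6 6) :=
  {(2, 4, 5), (0, 4, 1), (2, 0, 2), (0, 5, 4), (1, 4, 0), (3, 2, 4), (0, 1, 2), (1, 4, 5)}

/-- Duplicate-freeness test by a bit set. -/
def nd : ℕ → List ℕ → Bool
  | _, [] => true
  | acc, a :: L => !(acc.testBit a) && nd (acc ||| 2 ^ a) L

theorem nd_sound : ∀ (L : List ℕ) (acc : ℕ), nd acc L = true →
    L.Nodup ∧ ∀ a ∈ L, acc.testBit a = false := by
  intro L
  induction L with
  | nil => intro acc _; simp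
  | cons a L ih =>
    intro acc h
    simp only [nd, Bool.and_eq_true, Bool.not_eq_true'] at h
    obtain ⟨h1, h2⟩ := ih _ h.2
    refine ⟨List.nodup_cons.2 ⟨?_, h1⟩, ?_⟩
    · intro ha
      have := h2 a ha
      simp [Nat.testBit_or] at this
    · intro b hb
      rcases List.mem_cons.1 hb with rfl | hb
      · exact h.1
      · have := h2 b hb
        rw [Nat.testBit_or, Bool.or_eq_false_iff] at this
        exact this.1

def L8 : List (Question 4 6 6) :=
  [(2, 4, 5), (0, 4, 1), (2, 0, 2), (0, 5, 4), (1, 4, 0), (3, 2, 4), (0, 1, 2), (1, 4, 5)]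

def code (s : Question 4 6 6) : ℕ := (L8.map (g s)).foldl (fun x y => 4 * x + y) 0

def allQ : List (Question 4 6 6) :=
  List.product (List.finRange 4) (List.product (List.finRange 6) (List.finRange 6))

set_option maxRecDepth 100000 in
theorem nd8 : nd 0 (allQ.map code) = true := by decide +kernel

theorem feas8 : Feasible Q8 := by
  intro s s' hne
  by_contra hc
  push Not at hc
  apply hne
  have hm : ∀ t : Question 4 6 6, t ∈ allQ := by
    intro t
    obtain ⟨i, j, k⟩ := t
    exact List.mem_product.2 ⟨List.mem_finRange i,
      List.mem_product.2 ⟨List.mem_finRange j, List.mem_finRange k⟩⟩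
  refine List.inj_on_of_nodup_map (nd_sound _ _ nd8).1 (hm s) (hm s') ?_
  unfold code
  congr 1
  apply List.map_congr_left
  intro q hq
  apply hc
  simpa [Q8, L8] using hq

end MM

theorem f_466 :
    f 4 6 6 = 8 ∧ ¬∃ Q : Finset (Question 4 6 6), Feasible Q ∧ Q.card = 7 := by
  refine ⟨?_, fun ⟨Q, hQ, hc⟩ => MM.no7 Q hQ hc⟩
  unfold f
  have hmem : 8 ∈ {n : ℕ | ∃ Q : Finset (Question 4 6 6), Feasible Q ∧ Q.card = n} :=
    ⟨MM.Q8, MM.feas8, by decide +kernel⟩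
  apply le_antisymm
  · exact Nat.sInf_le hmem
  · apply le_csInf ⟨8, hmem⟩
    rintro n ⟨Q, hQ, rfl⟩
    exact MM.no_le Q hQ
end

section
/- Let Q be a feasible strategy for (a,b,c)-Mastermind. Then Q does not contain three distinct questions q1, q2, q3 such that q1 is a (1,1,⋆)-question, q2 is a (1,⋆,1)-question, and q3 is a (⋆,1,1)-question. -/
/-- Number of questions of `Q` sharing the first coordinate of `q`. -/
def cnt1 {a b c : ℕ} (Q : Finset (Question a b c)) (q : Question a b c) : ℕ :=
  (Q.filter (fun q' => q'.1 = q.1)).card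

/-- Number of questions of `Q` sharing the second coordinate of `q`. -/
def cnt2 {a b c : ℕ} (Q : Finset (Question a b c)) (q : Question a b c) : ℕ :=
  (Q.filter (fun q' => q'.2.1 = q.2.1)).card

/-- Number of questions of `Q` sharing the third coordinate of `q`. -/
def cnt3 {a b c : ℕ} (Q : Finset (Question a b c)) (q : Question a b c) : ℕ :=
  (Q.filter (fun q' => q'.2.2 = q.2.2)).card

theorem no_three_singleton_questions (a b c : ℕ) (ha : 0 < a) (hb : 0 < b)
    (hc : 0 < c) (Q : Finset (Question a b c)) (hQ : Feasible Q) :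
    ¬∃ q1 ∈ Q, ∃ q2 ∈ Q, ∃ q3 ∈ Q,
      q1 ≠ q2 ∧ q1 ≠ q3 ∧ q2 ≠ q3 ∧
      (cnt1 Q q1 = 1 ∧ cnt2 Q q1 = 1) ∧
      (cnt1 Q q2 = 1 ∧ cnt3 Q q2 = 1) ∧
      (cnt2 Q q3 = 1 ∧ cnt3 Q q3 = 1) := by
  rintro ⟨q1, h1, q2, h2, q3, h3, h12, h13, h23, ⟨u1, u2⟩, ⟨v1, v3⟩, ⟨w2, w3⟩⟩
  -- each singleton count says the question is determined by that coordinate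
  have key : ∀ (P : Question a b c → Prop) [DecidablePred P] (q : Question a b c),
      q ∈ Q → P q → (Q.filter P).card = 1 → ∀ r ∈ Q, (P r ↔ r = q) := by
    intro P _ q hq hP hcard r hr
    constructor
    · intro hPr
      exact Finset.card_le_one.mp hcard.le r (by simp [hr, hPr]) q (by simp [hq, hP])
    · rintro rfl
      exact hP
  have k1 := key (fun q' => q'.1 = q1.1) q1 h1 rfl u1
  have k2 := key (fun q' => q'.2.1 = q1.2.1) q1 h1 rfl u2
  have k3 := key (fun q' => q'.1 = q2.1) q2 h2 rfl v1
  have k4 := key (fun q' => q'.2.2 = q2.2.2) q2 h2 rfl v3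
  have k5 := key (fun q' => q'.2.1 = q3.2.1) q3 h3 rfl w2
  have k6 := key (fun q' => q'.2.2 = q3.2.2) q3 h3 rfl w3
  -- the secrets (x1, y3, z2) and (x2, y1, z3) receive identical answers
  obtain ⟨q, hq, hne⟩ := hQ (q1.1, q3.2.1, q2.2.2) (q2.1, q1.2.1, q3.2.2) (by
    intro h
    exact h12 ((k3 q1 h1).mp (Prod.mk.inj h).1))
  apply hne
  simp only [g, eq_comm (b := q.1), eq_comm (b := q.2.1), eq_comm (b := q.2.2),
    k1 q hq, k2 q hq, k3 q hq, k4 q hq, k5 q hq, k6 q hq]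
  omega
end
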